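/- arXiv:2008.05837 — 2 statements merged into one kernel-verified Lean document; each statement's English description precedes it below -/
import Mathlib

section
/- For every ε > 0 there exists Q₀ such that the following holds for every integer q ≥ Q₀: if GRH(χ) is true for every nonprincipal Dirichlet character χ modulo q, then ∑_{χ mod q} ord_{s=1/2} L(s,χ) ≤ (1/2 + ε)·φ(q), where the sum runs over all Dirichlet characters modulo q and ord_{s=1/2} L(s,χ) denotes the order of vanishing of L(s,χ) at s = 1/2. -/
open Filter Real Complex
open scoped Classical

/-- The analytically continued Dirichlet L-function `L(s,χ)`
(with junk value `1` for the modulus `0`). -/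
noncomputable def Lfunc (q : ℕ) (χ : DirichletCharacter ℂ q) (s : ℂ) : ℂ :=
  if h : q = 0 then 1 else
    letI : NeZero q := ⟨h⟩
    DirichletCharacter.LFunction χ s

/-- The generalized Riemann hypothesis for the character `χ`: every zero of `L(s,χ)`
with `0 < Re s < 1` lies on the critical line. -/
def GRHchi {q : ℕ} (χ : DirichletCharacter ℂ q) : Prop :=
  ∀ s : ℂ, 0 < s.re → s.re < 1 → Lfunc q χ s = 0 → s.re = 1 / 2

/-- Order of vanishing of an (analytic) function at a point: the least `n` with
`f^(n)(z) ≠ 0`. -/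
noncomputable def ordAt (f : ℂ → ℂ) (z : ℂ) : ℕ :=
  sInf {n : ℕ | iteratedDeriv n f z ≠ 0}

/-- A nonvanishing holomorphic function on a disc has a holomorphic logarithm there. -/
theorem exists_log_on_ball {f : ℂ → ℂ} {c : ℂ} {R : ℝ} (hR : 0 < R)
    (hf : DifferentiableOn ℂ f (Metric.ball c R)) (hne : ∀ z ∈ Metric.ball c R, f z ≠ 0) :
    ∃ g : ℂ → ℂ, g c = 0 ∧ (∀ z ∈ Metric.ball c R, HasDerivAt g (deriv f z / f z) z) ∧
      ∀ z ∈ Metric.ball c R, f z = f c * Complex.exp (g z) := by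
  have hc : c ∈ Metric.ball c R := Metric.mem_ball_self hR
  have hd : DifferentiableOn ℂ (fun z => deriv f z / f z) (Metric.ball c R) :=
    (hf.deriv Metric.isOpen_ball).div hf hne
  obtain ⟨g₀, hg₀⟩ := hd.isExactOn_ball
  have hg (z) (hz : z ∈ Metric.ball c R) :
      HasDerivAt (fun z => g₀ z - g₀ c) (deriv f z / f z) z := (hg₀ z hz).sub_const _
  refine ⟨fun z => g₀ z - g₀ c, by simp, hg, fun z hz => ?_⟩
  have hk (w) (hw : w ∈ Metric.ball c R) :
      HasDerivAt (fun z => f z * Complex.exp (-(g₀ z - g₀ c))) 0 w := by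
    have h1 := (hf.differentiableAt (Metric.isOpen_ball.mem_nhds hw)).hasDerivAt
    have h2 := (hg w hw).neg.cexp
    refine (h1.mul h2).congr_deriv ?_
    have := hne w hw
    simp only [Pi.neg_apply]
    field_simp
    ring
  have hconst := (convex_ball c R).is_const_of_fderivWithin_eq_zero (𝕜 := ℂ)
    (f := fun z => f z * Complex.exp (-(g₀ z - g₀ c)))
    (fun w hw => (hk w hw).differentiableAt.differentiableWithinAt)
    (fun w hw => by
      rw [fderivWithin_of_isOpen Metric.isOpen_ball hw, (hk w hw).hasFDerivAt.fderiv]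
      ext; simp) hz hc
  simp only [sub_self, neg_zero, Complex.exp_zero, mul_one] at hconst
  rw [← hconst, mul_assoc, ← Complex.exp_add]
  simp

/-- The Borel-Carathéodory theorem applied to the logarithm of a nonvanishing function. -/
theorem norm_logDeriv_le_and_lower_bound {f : ℂ → ℂ} {c : ℂ} {r R M : ℝ} (hr : 0 < r)
    (hrR : r < R) (hM : 0 < M)
    (hf : DifferentiableOn ℂ f (Metric.ball c R)) (hne : ∀ z ∈ Metric.ball c R, f z ≠ 0)
    (hb : ∀ z ∈ Metric.ball c R, ‖f z‖ ≤ Real.exp M * ‖f c‖) {z : ℂ}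
    (hz : z ∈ Metric.closedBall c r) :
    ‖deriv f z / f z‖ ≤ 8 * R / (R - r) ^ 2 * M ∧
      ‖f c‖ * Real.exp (-(2 * r / (R - r)) * M) ≤ ‖f z‖ := by
  have hR : 0 < R := hr.trans hrR
  have hd : 0 < R - r := sub_pos.2 hrR
  have hc : c ∈ Metric.ball c R := Metric.mem_ball_self hR
  obtain ⟨g, hgc, hg, hgf⟩ := exists_log_on_ball hR hf hne
  have hfc : 0 < ‖f c‖ := norm_pos_iff.2 (hne c hc)
  have hre (w) (hw : w ∈ Metric.ball c R) : (g w).re ≤ M := by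
    have h := hb w hw
    rw [hgf w hw, norm_mul, Complex.norm_exp, mul_comm] at h
    exact Real.exp_le_exp.1 (le_of_mul_le_mul_right h hfc)
  have hmem (w : ℂ) : w ∈ Metric.ball (0 : ℂ) R ↔ c + w ∈ Metric.ball c R := by simp
  have hBC (w) (hw : w ∈ Metric.ball c R) : ‖g w‖ ≤ 2 * M * ‖w - c‖ / (R - ‖w - c‖) := by
    have := Complex.borelCaratheodory_zero (f := fun u => g (c + u)) (z := w - c) (R := R) hM
      (fun u hu => by
        have := (hg _ ((hmem u).1 hu)).comp_const_add c u
        exact this.differentiableAt.differentiableWithinAt)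
      (fun u hu => hre _ ((hmem u).1 hu)) hR ((hmem _).2 (by simpa using hw)) (by simp [hgc])
    simpa using this
  have hzr : ‖z - c‖ ≤ r := by simpa [dist_eq_norm] using hz
  have hzR : z ∈ Metric.ball c R := by
    simpa [dist_eq_norm] using hzr.trans_lt hrR
  constructor
  · rw [← (hg z hzR).deriv]
    have hsub : Metric.closedBall z ((R - r) / 2) ⊆ Metric.ball c R := by
      intro w hw
      have : ‖w - z‖ ≤ (R - r) / 2 := by simpa [dist_eq_norm] using hw
      have h2 : ‖w - c‖ ≤ ‖w - z‖ + ‖z - c‖ := norm_sub_le_norm_sub_add_norm_sub w z c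
      simp only [Metric.mem_ball, dist_eq_norm]
      linarith
    have hdiff : DiffContOnCl ℂ g (Metric.ball z ((R - r) / 2)) := by
      refine DifferentiableOn.diffContOnCl_ball (U := Metric.ball c R) (fun w hw => ?_) hsub
      exact (hg w hw).differentiableAt.differentiableWithinAt
    have := Complex.norm_deriv_le_of_forall_mem_sphere_norm_le (C := 4 * M * R / (R - r))
      (half_pos hd) hdiff (fun w hw => ?_)
    · refine this.trans (le_of_eq ?_)
      field_simp
      norm_num
    · have hw' := hsub (Metric.sphere_subset_closedBall hw)
      have : ‖w - z‖ = (R - r) / 2 := by simpa [dist_eq_norm] using hw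
      have h2 : ‖w - c‖ ≤ ‖w - z‖ + ‖z - c‖ := norm_sub_le_norm_sub_add_norm_sub w z c
      have h3 : ‖w - c‖ ≤ R := by linarith
      have h4 : (R - r) / 2 ≤ R - ‖w - c‖ := by linarith
      calc ‖g w‖ ≤ 2 * M * ‖w - c‖ / (R - ‖w - c‖) := hBC w hw'
        _ ≤ 2 * M * R / ((R - r) / 2) := by gcongr
        _ = 4 * M * R / (R - r) := by field_simp; norm_num
  · rw [hgf z hzR, norm_mul, Complex.norm_exp]
    gcongr
    have h1 : ‖g z‖ ≤ 2 * r / (R - r) * M := by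
      calc ‖g z‖ ≤ 2 * M * ‖z - c‖ / (R - ‖z - c‖) := hBC z hzR
        _ ≤ 2 * M * r / (R - r) := by gcongr
        _ = _ := by ring
    linarith [neg_abs_le (g z).re, Complex.abs_re_le_norm (g z)]

theorem norm_Gamma_le_Gamma_re {z : ℂ} (hz : 0 < z.re) :
    ‖Complex.Gamma z‖ ≤ Real.Gamma z.re := by
  rw [Complex.Gamma_eq_integral hz, Complex.GammaIntegral, Real.Gamma_eq_integral hz]
  refine (MeasureTheory.norm_integral_le_integral_norm _).trans (le_of_eq ?_)
  refine MeasureTheory.setIntegral_congr_fun measurableSet_Ioi fun x hx => ?_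
  have hx : 0 < x := hx
  simp only [norm_mul, Complex.norm_real, Real.norm_eq_abs, abs_of_pos (Real.exp_pos _)]
  rw [Complex.norm_cpow_eq_rpow_re_of_pos hx]
  simp

theorem exp_neg_le_norm_Gamma_half (y : ℝ) :
    Real.exp (-(2 * |y|)) ≤ ‖Complex.Gamma (1 / 2 + y * I)‖ := by
  have h := Complex.Gamma_mul_Gamma_one_sub (1 / 2 + y * I)
  have hconj : (1 : ℂ) - (1 / 2 + y * I) = (starRingEnd ℂ) (1 / 2 + y * I) := by
    apply Complex.ext <;> simp; norm_num
  rw [hconj, Complex.Gamma_conj, Complex.mul_conj, Complex.normSq_eq_norm_sq] at h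
  have h2 : ‖Complex.Gamma (1 / 2 + y * I)‖ ^ 2 =
      π / ‖Complex.sin (π * (1 / 2 + y * I))‖ := by
    have := congrArg norm h
    simpa [abs_of_pos Real.pi_pos] using this
  have hs0 : 0 < ‖Complex.sin (π * (1 / 2 + y * I))‖ := by
    have : (0 : ℝ) < ‖Complex.Gamma (1 / 2 + y * I)‖ ^ 2 := by
      have := Complex.Gamma_ne_zero_of_re_pos (s := 1 / 2 + y * I) (by simp)
      positivity
    rw [h2] at this
    by_contra hcon
    have h0 : ‖Complex.sin (π * (1 / 2 + y * I))‖ = 0 :=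
      le_antisymm (not_lt.1 hcon) (norm_nonneg _)
    rw [h0, div_zero] at this
    exact lt_irrefl _ this
  have hs : ‖Complex.sin (π * (1 / 2 + y * I))‖ ≤ Real.exp (4 * |y|) := by
    have h3 : Complex.sin (π * (1 / 2 + y * I)) = Complex.cosh (π * y : ℝ) := by
      rw [show (π : ℂ) * (1 / 2 + y * I) = (π * y : ℝ) * I + π / 2 by push_cast; ring,
        Complex.sin_add_pi_div_two, Complex.cos_mul_I]
    rw [h3, ← Complex.ofReal_cosh, Complex.norm_real, Real.norm_eq_abs, abs_of_pos (Real.cosh_pos _),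
      ← Real.cosh_abs, abs_mul, abs_of_pos Real.pi_pos, Real.cosh_eq]
    have h4 : Real.exp (π * |y|) ≤ Real.exp (4 * |y|) :=
      Real.exp_le_exp.2 (mul_le_mul_of_nonneg_right Real.pi_le_four (abs_nonneg y))
    have h5 : Real.exp (-(π * |y|)) ≤ Real.exp (4 * |y|) :=
      Real.exp_le_exp.2 (by nlinarith [Real.pi_pos, abs_nonneg y])
    linarith
  have h6 : Real.exp (-(2 * |y|)) ^ 2 ≤ ‖Complex.Gamma (1 / 2 + y * I)‖ ^ 2 := by
    rw [h2, le_div_iff₀ hs0]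
    calc Real.exp (-(2 * |y|)) ^ 2 * ‖Complex.sin (π * (1 / 2 + y * I))‖
        ≤ Real.exp (-(2 * |y|)) ^ 2 * Real.exp (4 * |y|) := by gcongr
      _ = 1 := by rw [← Real.exp_nat_mul, ← Real.exp_add]; simp; ring
      _ ≤ π := by linarith [Real.pi_gt_three]
  exact le_of_abs_le (abs_le_of_sq_le_sq h6 (norm_nonneg _))

/-- Stirling-type bounds for `Γ` and the digamma function in a vertical strip. -/
theorem exists_Gamma_strip_bounds : ∃ C > 0, ∀ z : ℂ, 1 / 4 ≤ z.re → z.re ≤ 2 →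
    ‖deriv Complex.Gamma z / Complex.Gamma z‖ ≤ C * (1 + |z.im|) ∧
      Real.exp (-(C * (1 + |z.im|))) ≤ ‖Complex.Gamma z‖ := by
  obtain ⟨B, hB⟩ : ∃ B, ∀ x ∈ Set.Icc (1 / 8 : ℝ) 3, Real.Gamma x ≤ B := by
    have : ContinuousOn Real.Gamma (Set.Icc (1 / 8 : ℝ) 3) := fun x hx =>
      (Real.differentiableAt_Gamma (fun m => by
        have := hx.1
        have : (0 : ℝ) ≤ m := m.cast_nonneg
        intro h; linarith)).continuousAt.continuousWithinAt
    obtain ⟨B, hB⟩ := (isCompact_Icc.image_of_continuousOn this).bddAbove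
    exact ⟨B, fun x hx => hB ⟨x, hx, rfl⟩⟩
  set B' := |B| + 2 with hB'
  have hB'0 : 2 ≤ B' := by simp [hB']
  refine ⟨B' * 10000, by positivity, fun z hz1 hz2 => ?_⟩
  set y := z.im with hy
  set c : ℂ := 3 / 2 + y * I with hc
  have hcre : c.re = 3 / 2 := by simp [hc]
  have hcim : c.im = y := by simp [hc]
  have hy0 : 0 ≤ |y| := abs_nonneg y
  have hlow : Real.exp (-(2 + 2 * |y|)) ≤ ‖Complex.Gamma c‖ := by
    have h1 : Complex.Gamma c = (1 / 2 + y * I) * Complex.Gamma (1 / 2 + y * I) := by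
      rw [← Complex.Gamma_add_one]
      · congr 1; rw [hc]; ring
      · intro h; simpa using congrArg Complex.re h
    have h2 : (1 / 2 : ℝ) ≤ ‖(1 / 2 + y * I : ℂ)‖ := by
      simpa using Complex.re_le_norm (1 / 2 + y * I : ℂ)
    have h3 : Real.exp (-2) ≤ 1 / 2 := by
      have : (2 : ℝ) ≤ Real.exp 2 := by linarith [Real.add_one_le_exp (2 : ℝ)]
      rw [Real.exp_neg, one_div]
      exact inv_anti₀ (by norm_num) this
    rw [h1, norm_mul, neg_add, Real.exp_add]
    exact mul_le_mul (h3.trans h2) (exp_neg_le_norm_Gamma_half y) (Real.exp_nonneg _)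
      (norm_nonneg _)
  have hre (w) (hw : w ∈ Metric.ball c (11 / 8)) : 1 / 8 ≤ w.re ∧ w.re ≤ 3 := by
    have h1 : ‖w - c‖ < 11 / 8 := by simpa [dist_eq_norm] using hw
    have h2 := (Complex.abs_re_le_norm (w - c)).trans_lt h1
    rw [Complex.sub_re, hcre, abs_lt] at h2
    constructor <;> linarith
  have key := norm_logDeriv_le_and_lower_bound (f := Complex.Gamma) (c := c) (r := 5 / 4)
    (R := 11 / 8) (M := B' + (2 + 2 * |y|)) (by norm_num) (by norm_num) (by positivity)
    (fun w hw => (Complex.differentiableAt_Gamma w fun m h => by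
      have h1 := (hre w hw).1
      have h2 := congrArg Complex.re h
      have : (0 : ℝ) ≤ m := m.cast_nonneg
      simp only [Complex.neg_re, Complex.natCast_re] at h2
      linarith).differentiableWithinAt)
    (fun w hw => Complex.Gamma_ne_zero_of_re_pos (by linarith [(hre w hw).1]))
    (fun w hw => by
      have h1 : ‖Complex.Gamma w‖ ≤ B' := by
        refine (norm_Gamma_le_Gamma_re (by linarith [(hre w hw).1])).trans
          ((hB _ (hre w hw)).trans ?_)
        linarith [le_abs_self B]
      calc ‖Complex.Gamma w‖ ≤ Real.exp B' := h1.trans (by linarith [Real.add_one_le_exp B'])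
        _ = Real.exp (B' + (2 + 2 * |y|)) * Real.exp (-(2 + 2 * |y|)) := by
          rw [← Real.exp_add]; congr 1; ring
        _ ≤ _ := by gcongr)
    (z := z) (by
      have : z - c = ((z.re - 3 / 2 : ℝ) : ℂ) := by
        apply Complex.ext <;> simp [hcre, hcim, hy]
      simp only [Metric.mem_closedBall, dist_eq_norm, this, Complex.norm_real, Real.norm_eq_abs]
      exact abs_le.2 ⟨by linarith, by linarith⟩)
  have hbig : B' + (2 + 2 * |y|) ≤ 2 * B' * (1 + |y|) := by nlinarith
  constructor
  · refine key.1.trans ?_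
    norm_num
    nlinarith
  · refine le_trans ?_ key.2
    calc Real.exp (-(B' * 10000 * (1 + |y|)))
        ≤ Real.exp (-(2 + 2 * |y|) + -(2 * (5 / 4) / (11 / 8 - 5 / 4)) * (B' + (2 + 2 * |y|))) := by
          apply Real.exp_le_exp.2
          norm_num
          nlinarith
      _ = Real.exp (-(2 + 2 * |y|)) *
          Real.exp (-(2 * (5 / 4) / (11 / 8 - 5 / 4)) * (B' + (2 + 2 * |y|))) := by
          rw [Real.exp_add]
      _ ≤ _ := by gcongr

/-- A ratio of Gamma values with horizontally displaced arguments is bounded. -/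
theorem exists_norm_Gamma_sub_le {h : ℝ} (hh : 0 < h) : ∃ C, ∀ z : ℂ, 1 / 2 ≤ z.re - h →
    ‖Complex.Gamma (z - h)‖ ≤ C * ‖Complex.Gamma (z + h)‖ := by
  set F : ℝ → ℂ := fun x => (x : ℂ) ^ ((1 / 2 : ℂ) - 1) * (1 - (x : ℂ)) ^ (((2 * h : ℝ) : ℂ) - 1)
  have hF : IntervalIntegrable F MeasureTheory.volume 0 1 :=
    Complex.betaIntegral_convergent (by simp) (by simpa using hh)
  have hG : Complex.Gamma ((2 * h : ℝ) : ℂ) ≠ 0 :=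
    Complex.Gamma_ne_zero_of_re_pos (by simpa using hh)
  refine ⟨(∫ x in (0 : ℝ)..1, ‖F x‖) / ‖Complex.Gamma ((2 * h : ℝ) : ℂ)‖, fun z hz => ?_⟩
  have hz' : (1 / 2 : ℝ) ≤ (z - h).re := by simpa using hz
  have hB := Complex.Gamma_mul_Gamma_eq_betaIntegral (s := z - h) (t := ((2 * h : ℝ) : ℂ))
    (by linarith) (by simpa using hh)
  rw [show z - h + ((2 * h : ℝ) : ℂ) = z + h by push_cast; ring] at hB
  have hb : ‖Complex.betaIntegral (z - h) ((2 * h : ℝ) : ℂ)‖ ≤ ∫ x in (0 : ℝ)..1, ‖F x‖ := by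
    rw [Complex.betaIntegral]
    refine intervalIntegral.norm_integral_le_of_norm_le zero_le_one ?_ hF.norm
    filter_upwards with x hx
    simp only [F, norm_mul]
    gcongr ?_ * _
    rw [Complex.norm_cpow_eq_rpow_re_of_pos hx.1, Complex.norm_cpow_eq_rpow_re_of_pos hx.1]
    refine Real.rpow_le_rpow_of_exponent_ge hx.1 hx.2 ?_
    simp at hz' ⊢
    linarith
  have := congrArg norm hB
  rw [norm_mul, norm_mul] at this
  rw [div_mul_eq_mul_div, le_div_iff₀ (norm_pos_iff.2 hG), this, mul_comm]
  gcongr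

theorem hasDerivAt_Gammaℝ {s : ℂ} (hs : 0 < s.re) :
    HasDerivAt Complex.Gammaℝ (Complex.Gammaℝ s * (-(Complex.log π) / 2 +
      deriv Complex.Gamma (s / 2) / Complex.Gamma (s / 2) / 2)) s := by
  have hs2 : 0 < (s / 2).re := by simpa using hs
  have hpi : (π : ℂ) ≠ 0 := Complex.ofReal_ne_zero.2 Real.pi_ne_zero
  have h1 : HasDerivAt (fun s : ℂ => (π : ℂ) ^ (-s / 2))
      ((π : ℂ) ^ (-s / 2) * Complex.log π * (-1 / 2)) s :=
    (((hasDerivAt_id s).neg).div_const 2).const_cpow (Or.inl hpi)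
  have h2 : HasDerivAt (fun s : ℂ => Complex.Gamma (s / 2))
      (deriv Complex.Gamma (s / 2) * (1 / 2)) s := by
    have hd : HasDerivAt Complex.Gamma (deriv Complex.Gamma (s / 2)) (s / 2) :=
      (Complex.differentiableAt_Gamma _ fun m h => by
        have h2 := congrArg Complex.re h
        have : (0 : ℝ) ≤ m := m.cast_nonneg
        simp only [Complex.neg_re, Complex.natCast_re] at h2
        linarith).hasDerivAt
    exact hd.comp s ((hasDerivAt_id s).div_const 2)
  have h3 := h1.mul h2
  refine h3.congr_deriv ?_
  have := Complex.Gamma_ne_zero_of_re_pos hs2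
  rw [Complex.Gammaℝ_def]
  field_simp

theorem exists_Gammaℝ_strip_bounds : ∃ C > 0, ∀ s : ℂ, 1 / 2 ≤ s.re → s.re ≤ 4 →
    ‖deriv Complex.Gammaℝ s / Complex.Gammaℝ s‖ ≤ C * (1 + |s.im|) ∧
      Real.exp (-(C * (1 + |s.im|))) ≤ ‖Complex.Gammaℝ s‖ := by
  obtain ⟨C, hC, h⟩ := exists_Gamma_strip_bounds
  refine ⟨C + 4 + ‖Complex.log π‖, by positivity, fun s h1 h2 => ?_⟩
  have hre : (s / 2).re = s.re / 2 := by simp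
  have him : (s / 2).im = s.im / 2 := by simp
  obtain ⟨h3, h4⟩ := h (s / 2) (by rw [hre]; linarith) (by rw [hre]; linarith)
  have habs : |(s / 2).im| ≤ |s.im| := by
    rw [him, abs_div, abs_two]; linarith [abs_nonneg s.im]
  have hi := abs_nonneg s.im
  have hl := norm_nonneg (Complex.log π)
  have h5 : C * (1 + |(s / 2).im|) ≤ C * (1 + |s.im|) := by gcongr
  have hne := Complex.Gammaℝ_ne_zero_of_re_pos (s := s) (by linarith)
  constructor
  · rw [(hasDerivAt_Gammaℝ (by linarith)).deriv, mul_div_cancel_left₀ _ hne]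
    refine (norm_add_le _ _).trans ?_
    rw [norm_div, norm_div, norm_neg]
    simp only [Complex.norm_ofNat]
    nlinarith [norm_nonneg (deriv Complex.Gamma (s / 2) / Complex.Gamma (s / 2))]
  · rw [Complex.Gammaℝ_def, norm_mul, Complex.norm_cpow_eq_rpow_re_of_pos Real.pi_pos]
    have h6 : Real.exp (-4) ≤ π ^ (-s / 2).re := by
      have hp : Real.log π ≤ 2 := by
        rw [Real.log_le_iff_le_exp Real.pi_pos]
        have := Real.add_one_le_exp (1 : ℝ)
        have h2 : Real.exp 2 = Real.exp 1 * Real.exp 1 := by rw [← Real.exp_add]; norm_num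
        nlinarith [Real.pi_le_four]
      have hp0 : 0 ≤ Real.log π := Real.log_nonneg (by linarith [Real.pi_gt_three])
      rw [Real.rpow_def_of_pos Real.pi_pos]
      apply Real.exp_le_exp.2
      simp
      nlinarith
    calc Real.exp (-((C + 4 + ‖Complex.log π‖) * (1 + |s.im|)))
        ≤ Real.exp (-4 + -(C * (1 + |(s / 2).im|))) := by
          apply Real.exp_le_exp.2; nlinarith
      _ = Real.exp (-4) * Real.exp (-(C * (1 + |(s / 2).im|))) := Real.exp_add _ _
      _ ≤ _ := by gcongr

theorem gammaFactor_eq_or {N : ℕ} (χ : DirichletCharacter ℂ N) :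
    DirichletCharacter.gammaFactor χ = Complex.Gammaℝ ∨
      DirichletCharacter.gammaFactor χ = fun s => Complex.Gammaℝ (s + 1) := by
  by_cases h : χ.Even
  · left; ext s; exact h.gammaFactor_def s
  · right; ext s; simp [DirichletCharacter.gammaFactor, h]

theorem differentiableAt_gammaFactor {N : ℕ} (χ : DirichletCharacter ℂ N) {s : ℂ}
    (hs : 0 < s.re) : DifferentiableAt ℂ (DirichletCharacter.gammaFactor χ) s := by
  rcases gammaFactor_eq_or χ with h | h <;> rw [h]
  · exact (hasDerivAt_Gammaℝ hs).differentiableAt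
  · exact ((hasDerivAt_Gammaℝ (s := s + 1) (by simp; linarith)).comp_add_const s 1).differentiableAt

theorem gammaFactor_ne_zero {N : ℕ} (χ : DirichletCharacter ℂ N) {s : ℂ}
    (hs : 0 < s.re) : DirichletCharacter.gammaFactor χ s ≠ 0 := by
  rcases gammaFactor_eq_or χ with h | h <;> rw [h]
  · exact Complex.Gammaℝ_ne_zero_of_re_pos hs
  · exact Complex.Gammaℝ_ne_zero_of_re_pos (by simp; linarith)

theorem exists_gammaFactor_strip_bounds : ∃ C > 0, ∀ (N : ℕ) (χ : DirichletCharacter ℂ N) (s : ℂ),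
    1 / 2 ≤ s.re → s.re ≤ 2 →
    ‖deriv (DirichletCharacter.gammaFactor χ) s / DirichletCharacter.gammaFactor χ s‖ ≤
        C * (1 + |s.im|) ∧
      Real.exp (-(C * (1 + |s.im|))) ≤ ‖DirichletCharacter.gammaFactor χ s‖ := by
  obtain ⟨C, hC, h⟩ := exists_Gammaℝ_strip_bounds
  refine ⟨C, hC, fun N χ s h1 h2 => ?_⟩
  rcases gammaFactor_eq_or χ with hg | hg <;> rw [hg]
  · exact h s h1 (by linarith)
  · rw [deriv_comp_add_const]
    simpa using h (s + 1) (by simp; linarith) (by simp; linarith)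

theorem exists_norm_gammaFactor_sub_le {η : ℝ} (hη : 0 < η) :
    ∃ C > 0, ∀ (N : ℕ) (χ : DirichletCharacter ℂ N) (s : ℂ), 1 ≤ s.re - η →
    ‖DirichletCharacter.gammaFactor χ (s - η)‖ ≤
      C * ‖DirichletCharacter.gammaFactor χ (s + η)‖ := by
  obtain ⟨C₀, hC₀⟩ := exists_norm_Gamma_sub_le (half_pos hη)
  have key (s : ℂ) (hs : 1 ≤ s.re - η) : ‖Complex.Gammaℝ (s - η)‖ ≤
      (π ^ η * |C₀| + 1) * ‖Complex.Gammaℝ (s + η)‖ := by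
    have h1 := hC₀ (s / 2) (by simp; linarith)
    rw [Complex.Gammaℝ_def, Complex.Gammaℝ_def, norm_mul, norm_mul,
      Complex.norm_cpow_eq_rpow_re_of_pos Real.pi_pos,
      Complex.norm_cpow_eq_rpow_re_of_pos Real.pi_pos]
    rw [show (s - η) / 2 = s / 2 - ((η / 2 : ℝ) : ℂ) by push_cast; ring,
      show (s + η) / 2 = s / 2 + ((η / 2 : ℝ) : ℂ) by push_cast; ring]
    have h2 : π ^ (-(s - (η : ℂ)) / 2).re = π ^ η * π ^ (-(s + (η : ℂ)) / 2).re := by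
      rw [← Real.rpow_add Real.pi_pos]
      congr 1
      simp
      ring
    rw [h2]
    have hp : 0 < π ^ (-(s + (η : ℂ)) / 2).re := Real.rpow_pos_of_pos Real.pi_pos _
    have hp' : 0 < π ^ η := Real.rpow_pos_of_pos Real.pi_pos _
    set g := ‖Complex.Gamma (s / 2 + ((η / 2 : ℝ) : ℂ))‖
    have hg : 0 ≤ g := norm_nonneg _
    calc π ^ η * π ^ (-(s + (η : ℂ)) / 2).re * ‖Complex.Gamma (s / 2 - ((η / 2 : ℝ) : ℂ))‖
        ≤ π ^ η * π ^ (-(s + (η : ℂ)) / 2).re * (|C₀| * g) := by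
          gcongr
          exact h1.trans (mul_le_mul_of_nonneg_right (le_abs_self _) hg)
      _ ≤ (π ^ η * |C₀| + 1) * (π ^ (-(s + (η : ℂ)) / 2).re * g) := by
          nlinarith [mul_nonneg hp.le hg]
  refine ⟨π ^ η * |C₀| + 1, by positivity, fun N χ s hs => ?_⟩
  rcases gammaFactor_eq_or χ with hg | hg <;> rw [hg]
  · exact key s hs
  · have := key (s + 1) (by simp; linarith)
    convert this using 4 <;> ring

theorem exists_norm_mellin_le {f : ℝ → ℂ} (hf : ∀ s : ℂ, MellinConvergent f s) (a b : ℝ) :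
    ∃ M : ℝ, ∀ s : ℂ, a ≤ s.re → s.re ≤ b → ‖mellin f s‖ ≤ M := by
  have key : ∀ σ : ℝ, MeasureTheory.IntegrableOn
      (fun t : ℝ => t ^ (σ - 1) * ‖f t‖) (Set.Ioi 0) := by
    intro σ
    have h := (hf (σ : ℂ)).norm
    refine MeasureTheory.IntegrableOn.congr_fun h (fun t ht => ?_) measurableSet_Ioi
    have ht' : (0 : ℝ) < t := ht
    simp only [norm_smul]
    rw [Complex.norm_cpow_eq_rpow_re_of_pos ht']
    simp
  refine ⟨∫ t in Set.Ioi (0 : ℝ), (t ^ (a - 1) * ‖f t‖ + t ^ (b - 1) * ‖f t‖), fun s ha hb => ?_⟩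
  refine MeasureTheory.norm_integral_le_of_norm_le ((key a).add (key b)) ?_
  refine MeasureTheory.ae_restrict_of_forall_mem measurableSet_Ioi fun t ht => ?_
  have ht' : (0 : ℝ) < t := ht
  rw [norm_smul, Complex.norm_cpow_eq_rpow_re_of_pos ht', ← add_mul]
  refine mul_le_mul_of_nonneg_right ?_ (norm_nonneg _)
  simp only [Complex.sub_re, Complex.one_re]
  rcases le_total 1 t with h | h
  · have := Real.rpow_le_rpow_of_exponent_le h (sub_le_sub_right hb 1)
    have := Real.rpow_nonneg ht'.le (a - 1)
    linarith
  · have := Real.rpow_le_rpow_of_exponent_ge ht' h (sub_le_sub_right ha 1)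
    have := Real.rpow_nonneg ht'.le (b - 1)
    linarith

theorem exists_norm_completedHurwitzZeta_le (x : UnitAddCircle) (a b : ℝ) :
    ∃ M : ℝ, ∀ s : ℂ, a ≤ s.re → s.re ≤ b →
      ‖HurwitzZeta.completedHurwitzZetaEven₀ x s‖ ≤ M ∧
      ‖HurwitzZeta.completedHurwitzZetaOdd x s‖ ≤ M := by
  have h2 : ∀ s : ℂ, (s / 2).re = s.re / 2 := fun s => by
    rw [show (2 : ℂ) = ((2 : ℝ) : ℂ) by norm_num, Complex.div_ofReal_re]
  obtain ⟨M₁, h₁⟩ := exists_norm_mellin_le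
    (fun s => (HurwitzZeta.hurwitzEvenFEPair x).isStrongFEPair_toStrongFEPair.hasMellin s |>.1)
    (a / 2) (b / 2)
  obtain ⟨M₂, h₂⟩ := exists_norm_mellin_le
    (fun s => (HurwitzZeta.isStrong_hurwitzOddFEPair x).hasMellin s |>.1)
    ((a + 1) / 2) ((b + 1) / 2)
  refine ⟨max (M₁ / 2) (M₂ / 2), fun s ha hb => ⟨le_max_of_le_left ?_, le_max_of_le_right ?_⟩⟩
  · rw [HurwitzZeta.completedHurwitzZetaEven₀, norm_div]
    have := h₁ (s / 2) (by rw [h2]; linarith) (by rw [h2]; linarith)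
    rw [Complex.norm_ofNat]
    exact div_le_div_of_nonneg_right this (by norm_num)
  · rw [HurwitzZeta.completedHurwitzZetaOdd, norm_div,
      (HurwitzZeta.isStrong_hurwitzOddFEPair _).Λ_eq]
    have := h₂ ((s + 1) / 2) (by rw [h2]; simp; linarith) (by rw [h2]; simp; linarith)
    rw [Complex.norm_ofNat]
    exact div_le_div_of_nonneg_right this (by norm_num)

theorem exists_norm_completedLFunction_le {N : ℕ} [NeZero N] {χ : DirichletCharacter ℂ N}
    (hχ : χ ≠ 1) (a b : ℝ) :
    ∃ M : ℝ, ∀ s : ℂ, a ≤ s.re → s.re ≤ b →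
      ‖DirichletCharacter.completedLFunction χ s‖ ≤ M := by
  have hN : N ≠ 1 := by
    rintro rfl
    exact hχ (DirichletCharacter.level_one χ)
  have h0 : χ (0 : ZMod N) = 0 := χ.map_zero' hN
  have h1 : ∑ j, χ j = 0 := χ.sum_eq_zero_of_ne_one hχ
  choose M hM using fun x : UnitAddCircle => exists_norm_completedHurwitzZeta_le x a b
  have hNpos : (0 : ℝ) < N := by exact_mod_cast Nat.pos_of_ne_zero (NeZero.ne N)
  refine ⟨(N : ℝ) ^ (-a) * ∑ j : ZMod N, M (ZMod.toAddCircle j) +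
    (N : ℝ) ^ (-a) * ∑ j : ZMod N, M (ZMod.toAddCircle j), fun s ha hb => ?_⟩
  have hpow : ‖(N : ℂ) ^ (-s)‖ ≤ (N : ℝ) ^ (-a) := by
    rw [Complex.norm_natCast_cpow_of_pos (Nat.pos_of_ne_zero (NeZero.ne N))]
    refine Real.rpow_le_rpow_of_exponent_le ?_ (by simpa using ha)
    exact_mod_cast Nat.one_le_iff_ne_zero.mpr (NeZero.ne N)
  have hsum : ∀ g : UnitAddCircle → ℂ, (∀ x, ‖g x‖ ≤ M x) →
      ‖∑ j : ZMod N, χ j * g (ZMod.toAddCircle j)‖ ≤ ∑ j : ZMod N, M (ZMod.toAddCircle j) := by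
    intro g hg
    refine (norm_sum_le _ _).trans (Finset.sum_le_sum fun j _ => ?_)
    rw [norm_mul]
    calc _ ≤ 1 * ‖g (ZMod.toAddCircle j)‖ :=
          mul_le_mul_of_nonneg_right (χ.norm_le_one j) (norm_nonneg _)
      _ ≤ _ := by rw [one_mul]; exact hg _
  have heq : DirichletCharacter.completedLFunction χ s =
      (N : ℂ) ^ (-s) * ∑ j : ZMod N, χ j *
        HurwitzZeta.completedHurwitzZetaEven₀ (ZMod.toAddCircle j) s +
      (N : ℂ) ^ (-s) * ∑ j : ZMod N, χ j *
        HurwitzZeta.completedHurwitzZetaOdd (ZMod.toAddCircle j) s := by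
    rw [DirichletCharacter.completedLFunction, ZMod.completedLFunction_eq, h0, h1,
      ZMod.completedLFunction₀, mul_zero, zero_div, zero_div, sub_zero, sub_zero]
  rw [heq]
  have hp0 : 0 ≤ (N : ℝ) ^ (-a) := Real.rpow_nonneg hNpos.le _
  refine (norm_add_le _ _).trans (add_le_add ?_ ?_)
  · rw [norm_mul]
    exact mul_le_mul hpow (hsum (fun x => HurwitzZeta.completedHurwitzZetaEven₀ x s)
      fun x => (hM x s ha hb).1) (norm_nonneg _) hp0
  · rw [norm_mul]
    exact mul_le_mul hpow (hsum (fun x => HurwitzZeta.completedHurwitzZetaOdd x s)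
      fun x => (hM x s ha hb).2) (norm_nonneg _) hp0

theorem exists_norm_LSeries_le {σ : ℝ} (hσ : 1 < σ) :
    ∃ C > 0, ∀ f : ℕ → ℂ, (∀ n, ‖f n‖ ≤ 1) → ∀ s : ℂ, σ ≤ s.re → ‖LSeries f s‖ ≤ C := by
  have hsum : Summable fun n => ‖LSeries.term 1 (σ : ℂ) n‖ :=
    (LSeriesSummable_one_iff.mpr (by simpa using hσ)).norm
  refine ⟨∑' n, ‖LSeries.term 1 (σ : ℂ) n‖ + 1,
    add_pos_of_nonneg_of_pos (tsum_nonneg fun _ => norm_nonneg _) one_pos, fun f hf s hs => ?_⟩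
  have hle : ∀ n, ‖LSeries.term f s n‖ ≤ ‖LSeries.term 1 (σ : ℂ) n‖ := fun n =>
    (LSeries.norm_term_le_of_re_le_re f (s := (σ : ℂ)) (by simpa using hs) n).trans
      (LSeries.norm_term_le _ (by simpa using hf n))
  have := tsum_of_norm_bounded hsum.hasSum hle
  rw [LSeries]
  linarith

theorem exists_LFunction_bounds {σ : ℝ} (hσ : 1 < σ) :
    ∃ C > 0, ∀ (N : ℕ) [NeZero N] (χ : DirichletCharacter ℂ N) (s : ℂ), σ ≤ s.re →
      ‖DirichletCharacter.LFunction χ s‖ ≤ C ∧ C⁻¹ ≤ ‖DirichletCharacter.LFunction χ s‖ := by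
  obtain ⟨C, hC, h⟩ := exists_norm_LSeries_le hσ
  refine ⟨C, hC, fun N _ χ s hs => ?_⟩
  have hs1 : 1 < s.re := hσ.trans_le hs
  rw [DirichletCharacter.LFunction_eq_LSeries χ hs1]
  have hχ : ∀ n : ℕ, ‖χ (n : ZMod N)‖ ≤ 1 := fun n => χ.norm_le_one _
  refine ⟨h _ hχ s hs, ?_⟩
  have hmul := DirichletCharacter.LSeries.mul_mu_eq_one χ hs1
  have hμ := h ((fun n : ℕ => χ (n : ZMod N)) *
    fun n => ((ArithmeticFunction.moebius n : ℤ) : ℂ)) (fun n => by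
      rw [Pi.mul_apply, norm_mul]
      refine mul_le_one₀ (hχ n) (norm_nonneg _) ?_
      rw [Complex.norm_intCast]
      exact_mod_cast ArithmeticFunction.abs_moebius_le_one) s hs
  have hn := congrArg norm hmul
  rw [norm_mul, norm_one] at hn
  rw [inv_le_iff_one_le_mul₀ hC]
  calc (1 : ℝ) = _ := hn.symm
    _ ≤ _ := mul_le_mul_of_nonneg_left hμ (norm_nonneg _)

theorem completedLFunction_eq_gammaFactor_mul {N : ℕ} [NeZero N] (χ : DirichletCharacter ℂ N)
    {s : ℂ} (hs : 0 < s.re) : DirichletCharacter.completedLFunction χ s =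
      DirichletCharacter.gammaFactor χ s * DirichletCharacter.LFunction χ s := by
  have h0 : s ≠ 0 := by
    rintro rfl
    simp at hs
  rw [DirichletCharacter.LFunction_eq_completed_div_gammaFactor χ s (Or.inl h0),
    mul_div_cancel₀ _ (gammaFactor_ne_zero χ hs)]

theorem exists_completedLFunction_growth {N : ℕ} [NeZero N] {χ : DirichletCharacter ℂ N}
    (hχ : χ ≠ 1) (hG : ∀ s : ℂ, 1 / 2 < s.re → DirichletCharacter.LFunction χ s ≠ 0)
    {δ : ℝ} (hδ : 0 < δ) (hδ1 : δ ≤ 1) :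
    ∃ C > 0, ∀ s : ℂ, 1 / 2 + δ ≤ s.re → s.re ≤ 2 →
      ‖deriv (DirichletCharacter.completedLFunction χ) s /
        DirichletCharacter.completedLFunction χ s‖ ≤ C * (1 + |s.im|) ∧
      Real.exp (-(C * (1 + |s.im|))) ≤ ‖DirichletCharacter.completedLFunction χ s‖ := by
  obtain ⟨M, hM⟩ := exists_norm_completedLFunction_le hχ (1 / 2) 4
  obtain ⟨C₁, hC₁, hγ⟩ := exists_gammaFactor_strip_bounds
  obtain ⟨C₂, hC₂, hL⟩ := exists_LFunction_bounds (show (1 : ℝ) < 2 by norm_num)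
  set K : ℝ := Real.log (max M 1) + Real.log (max C₂ 1) + 1 with hK
  have hM1 : 0 ≤ Real.log (max M 1) := Real.log_nonneg (le_max_right _ _)
  have hC2 : 0 ≤ Real.log (max C₂ 1) := Real.log_nonneg (le_max_right _ _)
  have hMe : M ≤ Real.exp (Real.log (max M 1)) := by
    rw [Real.exp_log (by positivity)]; exact le_max_left _ _
  have hCe : Real.exp (-Real.log (max C₂ 1)) ≤ C₂⁻¹ := by
    rw [Real.exp_neg, Real.exp_log (by positivity)]
    exact inv_anti₀ hC₂ (le_max_left _ _)
  have hK0 : 0 < K := by positivity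
  set R : ℝ := 3 / 2 - δ / 2 with hR
  set r : ℝ := 3 / 2 - δ with hr
  have hr0 : 0 < r := by linarith
  have hrR : r < R := by linarith
  have hA : 0 < 8 * R / (R - r) ^ 2 := by
    have : 0 < R - r := by linarith
    have : 0 < R := by linarith
    positivity
  have hB : 0 < 2 * r / (R - r) := div_pos (by linarith) (by linarith)
  refine ⟨8 * R / (R - r) ^ 2 * (K + C₁) + (1 + 2 * r / (R - r)) * (K + C₁), by positivity,
    fun s hs1 hs2 => ?_⟩
  set c : ℂ := ⟨2, s.im⟩ with hc
  have hT : 1 ≤ 1 + |s.im| := by linarith [abs_nonneg s.im]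
  have hcl : Real.exp (-((K - Real.log (max M 1) + C₁) * (1 + |s.im|))) ≤
      ‖DirichletCharacter.completedLFunction χ c‖ := by
    rw [completedLFunction_eq_gammaFactor_mul χ (by simp [hc]), norm_mul]
    have h1 := (hγ N χ c (by norm_num [hc]) (by simp [hc])).2
    have h2 := (hL N χ c (by simp [hc])).2
    calc _ ≤ Real.exp (-(C₁ * (1 + |s.im|))) * Real.exp (-Real.log (max C₂ 1)) := by
          rw [← Real.exp_add]
          refine Real.exp_le_exp.mpr ?_
          rw [hK]
          nlinarith
      _ ≤ _ := mul_le_mul h1 (hCe.trans h2) (Real.exp_pos _).le (norm_nonneg _)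
  have hre : ∀ z ∈ Metric.ball c R, 1 / 2 < z.re ∧ z.re ≤ 4 := by
    intro z hz
    have h := (Complex.abs_re_le_norm (z - c)).trans_lt (mem_ball_iff_norm.mp hz)
    rw [Complex.sub_re, abs_lt] at h
    simp only [hc] at h
    constructor <;> linarith [h.1, h.2]
  have hmain := norm_logDeriv_le_and_lower_bound (f := DirichletCharacter.completedLFunction χ)
    (c := c) (M := (K + C₁) * (1 + |s.im|)) hr0 hrR (by positivity)
    (DirichletCharacter.differentiable_completedLFunction hχ).differentiableOn
    (fun z hz => by
      have h0 : 0 < z.re := by linarith [(hre z hz).1]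
      rw [completedLFunction_eq_gammaFactor_mul χ h0]
      exact mul_ne_zero (gammaFactor_ne_zero χ h0) (hG z (hre z hz).1))
    (fun z hz => by
      refine (hM z (hre z hz).1.le (hre z hz).2).trans (hMe.trans ?_)
      calc Real.exp (Real.log (max M 1)) ≤ Real.exp ((K + C₁) * (1 + |s.im|)) *
            Real.exp (-((K - Real.log (max M 1) + C₁) * (1 + |s.im|))) := by
            rw [← Real.exp_add]
            refine Real.exp_le_exp.mpr ?_
            nlinarith
        _ ≤ _ := mul_le_mul_of_nonneg_left hcl (Real.exp_pos _).le)
    (z := s) (by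
      rw [mem_closedBall_iff_norm, show s - c = ((s.re - 2 : ℝ) : ℂ) by
        apply Complex.ext <;> simp [hc], Complex.norm_real, Real.norm_eq_abs, abs_le]
      constructor <;> linarith)
  have hX : 0 < (K + C₁) * (1 + |s.im|) := by positivity
  constructor
  · refine hmain.1.trans ?_
    have : 0 < (1 + 2 * r / (R - r)) * ((K + C₁) * (1 + |s.im|)) := by positivity
    nlinarith
  · refine le_trans ?_ hmain.2
    calc _ ≤ Real.exp (-((K - Real.log (max M 1) + C₁) * (1 + |s.im|))) *
          Real.exp (-(2 * r / (R - r)) * ((K + C₁) * (1 + |s.im|))) := by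
          rw [← Real.exp_add]
          refine Real.exp_le_exp.mpr ?_
          have : 0 < 8 * R / (R - r) ^ 2 * ((K + C₁) * (1 + |s.im|)) := by positivity
          have : 0 ≤ Real.log (max M 1) * (1 + |s.im|) := by positivity
          nlinarith
      _ ≤ _ := mul_le_mul_of_nonneg_right hcl (Real.exp_pos _).le

theorem LFunction_inv_conj {N : ℕ} [NeZero N] (χ : DirichletCharacter ℂ N) {s : ℂ}
    (hs : 1 < s.re) : DirichletCharacter.LFunction χ⁻¹ (starRingEnd ℂ s) =
      starRingEnd ℂ (DirichletCharacter.LFunction χ s) := by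
  rw [DirichletCharacter.LFunction_eq_LSeries _ hs,
    DirichletCharacter.LFunction_eq_LSeries _ (by simpa using hs), LSeries, LSeries,
    Complex.conj_tsum]
  refine tsum_congr fun n => ?_
  rcases eq_or_ne n 0 with rfl | hn
  · simp
  · rw [LSeries.term_of_ne_zero hn, LSeries.term_of_ne_zero hn, map_div₀,
      ← MulChar.star_apply' χ]
    congr 1
    have harg : ((n : ℕ) : ℂ).arg ≠ Real.pi := by
      rw [Complex.natCast_arg]
      exact Real.pi_pos.ne
    rw [Complex.cpow_conj _ _ harg, Complex.conj_natCast]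

theorem gammaFactor_inv_conj {N : ℕ} (χ : DirichletCharacter ℂ N) (s : ℂ) :
    DirichletCharacter.gammaFactor χ⁻¹ (starRingEnd ℂ s) =
      starRingEnd ℂ (DirichletCharacter.gammaFactor χ s) := by
  have hΓ : ∀ z : ℂ, Complex.Gammaℝ (starRingEnd ℂ z) = starRingEnd ℂ (Complex.Gammaℝ z) := by
    intro z
    have hpi : ((Real.pi : ℝ) : ℂ).arg ≠ Real.pi := by
      rw [Complex.arg_ofReal_of_nonneg Real.pi_pos.le]
      exact Real.pi_pos.ne
    rw [Complex.Gammaℝ, Complex.Gammaℝ, map_mul, ← Complex.Gamma_conj, map_div₀,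
      show -(starRingEnd ℂ) z / 2 = starRingEnd ℂ (-z / 2) by
        rw [map_div₀, map_neg, Complex.conj_ofNat],
      Complex.cpow_conj _ _ hpi, Complex.conj_ofReal, Complex.conj_ofNat]
  have hval : χ⁻¹ (-1) = (χ (-1))⁻¹ := MulChar.inv_apply_eq_inv' χ (-1)
  rcases χ.even_or_odd with h | h
  · have h' : χ⁻¹.Even := by rw [DirichletCharacter.Even, hval, h, inv_one]
    rw [h.gammaFactor_def, h'.gammaFactor_def, hΓ]
  · have h' : χ⁻¹.Odd := by rw [DirichletCharacter.Odd, hval, h, inv_neg, inv_one]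
    rw [h.gammaFactor_def, h'.gammaFactor_def, ← hΓ, map_add, map_one]

theorem completedLFunction_inv_conj {N : ℕ} [NeZero N] {χ : DirichletCharacter ℂ N} (hχ : χ ≠ 1)
    (s : ℂ) : DirichletCharacter.completedLFunction χ⁻¹ (starRingEnd ℂ s) =
      starRingEnd ℂ (DirichletCharacter.completedLFunction χ s) := by
  have hχ' : χ⁻¹ ≠ 1 := inv_ne_one.mpr hχ
  have hd := DirichletCharacter.differentiable_completedLFunction hχ
  have hd' : Differentiable ℂ
      (fun z => starRingEnd ℂ (DirichletCharacter.completedLFunction χ⁻¹ (starRingEnd ℂ z))) :=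
    fun z => differentiableAt_conj_conj_iff.mpr
      ((DirichletCharacter.differentiable_completedLFunction hχ') (starRingEnd ℂ z))
  have heq := AnalyticOnNhd.eq_of_eventuallyEq (𝕜 := ℂ) (z₀ := 2)
    (hd.differentiableOn.analyticOnNhd isOpen_univ)
    (hd'.differentiableOn.analyticOnNhd isOpen_univ) (by
      have hopen : {z : ℂ | 1 < z.re} ∈ nhds (2 : ℂ) :=
        (isOpen_lt continuous_const Complex.continuous_re).mem_nhds (by simp)
      filter_upwards [hopen] with z hz
      have hz : 1 < z.re := hz
      rw [completedLFunction_eq_gammaFactor_mul χ (by linarith),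
        completedLFunction_eq_gammaFactor_mul χ⁻¹ (by rw [Complex.conj_re]; linarith),
        gammaFactor_inv_conj, LFunction_inv_conj χ hz, map_mul, Complex.conj_conj,
        Complex.conj_conj])
  have := congrFun heq s
  rw [this, Complex.conj_conj]

theorem norm_completedLFunction_one_sub {N : ℕ} [NeZero N] {χ : DirichletCharacter ℂ N}
    (hχ : χ ≠ 1) (hp : χ.IsPrimitive) (s : ℂ) :
    ‖DirichletCharacter.completedLFunction χ (1 - s)‖ = (N : ℝ) ^ (s.re - 1 / 2) *
      ‖DirichletCharacter.completedLFunction χ (starRingEnd ℂ s)‖ := by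
  have hN : 0 < N := Nat.pos_of_ne_zero (NeZero.ne N)
  have key : ∀ s : ℂ, ‖DirichletCharacter.completedLFunction χ (1 - s)‖ =
      (N : ℝ) ^ (s.re - 1 / 2) * ‖DirichletCharacter.rootNumber χ‖ *
      ‖DirichletCharacter.completedLFunction χ (starRingEnd ℂ s)‖ := by
    intro s
    have hc : ‖DirichletCharacter.completedLFunction χ⁻¹ s‖ =
        ‖DirichletCharacter.completedLFunction χ (starRingEnd ℂ s)‖ := by
      have := completedLFunction_inv_conj hχ (starRingEnd ℂ s)
      rw [Complex.conj_conj] at this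
      rw [this, RCLike.norm_conj]
    rw [hp.completedLFunction_one_sub, norm_mul, norm_mul, hc,
      Complex.norm_natCast_cpow_of_pos hN]
    norm_num
  have hNr : (0 : ℝ) < N := by exact_mod_cast hN
  have h2 : DirichletCharacter.completedLFunction χ 2 ≠ 0 := by
    rw [completedLFunction_eq_gammaFactor_mul χ (by norm_num)]
    exact mul_ne_zero (gammaFactor_ne_zero χ (by norm_num))
      (DirichletCharacter.LFunction_ne_zero_of_one_le_re χ (Or.inl hχ) (by norm_num))
  have h3 := key 2
  have h4 := key (-1)
  rw [show (1 : ℂ) - 2 = -1 by norm_num, show starRingEnd ℂ (2 : ℂ) = 2 from Complex.conj_ofNat 2]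
    at h3
  rw [show (1 : ℂ) - -1 = 2 by norm_num, show starRingEnd ℂ (-1 : ℂ) = -1 by simp, h3] at h4
  have hpow : (N : ℝ) ^ ((-1 : ℂ).re - 1 / 2) * (N : ℝ) ^ ((2 : ℂ).re - 1 / 2) = 1 := by
    rw [← Real.rpow_add hNr]
    norm_num
  have hW : ‖DirichletCharacter.rootNumber χ‖ ^ 2 = 1 := by
    have h2' := norm_ne_zero_iff.mpr h2
    have : ‖DirichletCharacter.completedLFunction χ 2‖ * 1 =
        ‖DirichletCharacter.completedLFunction χ 2‖ * ‖DirichletCharacter.rootNumber χ‖ ^ 2 := by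
      calc _ = (N : ℝ) ^ ((-1 : ℂ).re - 1 / 2) * (N : ℝ) ^ ((2 : ℂ).re - 1 / 2) *
          ‖DirichletCharacter.rootNumber χ‖ ^ 2 *
          ‖DirichletCharacter.completedLFunction χ 2‖ := by rw [mul_one]; linear_combination h4
        _ = _ := by rw [hpow]; ring
    exact (mul_left_cancel₀ h2' this).symm
  have hW1 : ‖DirichletCharacter.rootNumber χ‖ = 1 :=
    by
    nlinarith [norm_nonneg (DirichletCharacter.rootNumber χ)]
  rw [key s, hW1, mul_one]

theorem norm_sub_le_mul_norm_add_of_line {F : ℂ → ℂ} (hF : Differentiable ℂ F) {η K B A x₀ : ℝ}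
    (hη : 0 < η) (hne : ∀ s : ℂ, 1 / 2 < s.re → F s ≠ 0)
    (hline : ∀ s : ℂ, s.re = 1 / 2 → ‖F (s - η)‖ ≤ K * ‖F (s + η)‖)
    (hgrowth : ∀ s : ℂ, 1 / 2 < s.re →
      ‖F (s - η)‖ ≤ Real.exp (B * (1 + ‖s - 1 / 2‖)) * ‖F (s + η)‖)
    (hreal : ∀ x : ℝ, x₀ ≤ x → ‖F (x - η)‖ ≤ A * ‖F (x + η)‖) {s : ℂ} (hs : 1 / 2 ≤ s.re) :
    ‖F (s - η)‖ ≤ K * ‖F (s + η)‖ := by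
  set f : ℂ → ℂ := fun z => F (1 / 2 + z - η) / F (1 / 2 + z + η) with hf
  have hne' : ∀ z : ℂ, 0 ≤ z.re → F (1 / 2 + z + η) ≠ 0 := by
    intro z hz
    refine hne _ ?_
    simp only [Complex.add_re, Complex.ofReal_re]
    norm_num
    linarith
  have hdiff : DifferentiableOn ℂ f (closure {z : ℂ | 0 < z.re}) := by
    rw [Complex.closure_setOfPred_lt_re]
    intro z hz
    refine DifferentiableAt.differentiableWithinAt ?_
    exact DifferentiableAt.div (hF.comp (by fun_prop) z) (hF.comp (by fun_prop) z) (hne' z hz)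
  have hle : ∀ z : ℂ, 0 ≤ z.re → ∀ k : ℝ, ‖F (1 / 2 + z - η)‖ ≤ k * ‖F (1 / 2 + z + η)‖ →
      ‖f z‖ ≤ k := by
    intro z hz k h
    rw [hf]
    simp only [norm_div]
    exact (div_le_iff₀ (norm_pos_iff.mpr (hne' z hz))).mpr h
  have hmain := PhragmenLindelof.right_half_plane_of_bounded_on_real (f := f) (C := K)
    (z := s - 1 / 2) hdiff.diffContOnCl ⟨1, by norm_num, B, by
      refine Asymptotics.IsBigO.of_bound (Real.exp B) ?_
      refine Filter.Eventually.filter_mono inf_le_right ?_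
      refine Filter.eventually_principal.mpr fun z hz => ?_
      have hz : 0 < z.re := hz
      refine (hle z hz.le _ (hgrowth (1 / 2 + z) (by simpa using hz))).trans ?_
      rw [add_sub_cancel_left, mul_add, Real.exp_add, mul_one, Real.rpow_one, Real.norm_eq_abs,
        Real.abs_exp]⟩
    (by
      refine ⟨A, ?_⟩
      rw [Filter.eventually_map]
      filter_upwards [Filter.eventually_ge_atTop (max 0 (x₀ - 1 / 2))] with x hx
      refine hle x (by simpa using (le_max_left _ _).trans hx) _ ?_
      have := hreal (1 / 2 + x) (by linarith [(le_max_right 0 (x₀ - 1 / 2)).trans hx])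
      push_cast at this
      exact this)
    (fun x => hle _ (by simp) _ (hline _ (by simp)))
    (by simp; linarith)
  have h0 := hne' (s - 1 / 2) (by simp; linarith)
  rw [hf] at hmain
  simp only [norm_div] at hmain
  rw [div_le_iff₀ (norm_pos_iff.mpr h0)] at hmain
  rwa [show (1 : ℂ) / 2 + (s - 1 / 2) = s by ring] at hmain

theorem re_logDeriv_nonneg_of_norm_sub_le {F : ℂ → ℂ} (hF : Differentiable ℂ F) {d : ℝ}
    (hd : 0 < d) {s : ℂ} (h0 : F s ≠ 0)
    (h : ∀ᶠ η : ℝ in nhdsWithin 0 (Set.Ioi 0), ‖F (s - η)‖ ≤ d ^ η * ‖F (s + η)‖) :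
    0 ≤ 1 / 2 * Real.log d + (deriv F s / F s).re := by
  have hder : ∀ c : ℝ, HasDerivAt (fun η : ℝ => Real.log (‖F (s + (c * η : ℝ))‖ ^ 2))
      (2 * c * (deriv F s / F s).re) 0 := by
    intro c
    have h1 : HasDerivAt (fun η : ℝ => F (s + (c * η : ℝ))) (deriv F s * c) (0 : ℝ) := by
      have hg : HasDerivAt (fun η : ℝ => s + ((c * η : ℝ) : ℂ)) (c : ℂ) (0 : ℝ) := by
        have := (((hasDerivAt_id (0 : ℝ)).const_mul c).ofReal_comp).const_add s
        simpa using this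
      have hFs : HasDerivAt F (deriv F s) (s + ((c * (0 : ℝ) : ℝ) : ℂ)) := by
        simpa using (hF s).hasDerivAt
      exact hFs.comp (0 : ℝ) hg
    have h2 := h1.norm_sq
    have h3 := h2.log (by simpa using h0)
    convert h3 using 1
    simp only [mul_zero, Complex.ofReal_zero, add_zero, Complex.inner]
    rw [Complex.div_re, Complex.sq_norm]
    simp only [Complex.mul_re, Complex.mul_im, Complex.conj_re, Complex.conj_im,
      Complex.ofReal_re, Complex.ofReal_im]
    have : Complex.normSq (F s) ≠ 0 := by simpa using h0
    field_simp
    ring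
  have hψ := ((hder 1).sub (hder (-1))).add
    ((hasDerivAt_id (0 : ℝ)).const_mul (2 * Real.log d))
  have hlim := hψ.tendsto_slope_zero_right
  have hcont : ∀ᶠ η : ℝ in nhdsWithin 0 (Set.Ioi 0), F (s - η) ≠ 0 := by
    have hc : ContinuousAt (fun η : ℝ => F (s - η)) 0 :=
      (hF.continuous.comp (by fun_prop)).continuousAt
    exact nhdsWithin_le_nhds (hc.eventually_ne (by simpa using h0))
  have hge : 0 ≤ 2 * 1 * (deriv F s / F s).re - 2 * (-1) * (deriv F s / F s).re +
      2 * Real.log d * 1 := by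
    refine ge_of_tendsto hlim ?_
    filter_upwards [h, hcont, self_mem_nhdsWithin] with η hη hη0 hηpos
    have hηpos : 0 < η := hηpos
    have hn : 0 < ‖F (s - η)‖ := norm_pos_iff.mpr hη0
    have hn' : 0 < ‖F (s + η)‖ := by
      by_contra hcon
      have : ‖F (s + η)‖ = 0 := le_antisymm (not_lt.mp hcon) (norm_nonneg _)
      rw [this, mul_zero] at hη
      linarith
    have hlog := Real.log_le_log hn hη
    rw [Real.log_mul (by positivity) hn'.ne', Real.log_rpow hd] at hlog
    simp only [smul_eq_mul, zero_add, Pi.add_apply, Pi.sub_apply, id, mul_zero,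
      Complex.ofReal_zero, add_zero, sub_self, one_mul, sub_zero, Real.log_pow]
    refine mul_nonneg (inv_nonneg.mpr hηpos.le) ?_
    rw [show ((-1 * η : ℝ) : ℂ) = -(η : ℂ) by push_cast; ring, ← sub_eq_add_neg]
    push_cast
    linarith
  linarith

theorem exists_eq_pow_mul_of_le_analyticOrderAt {f : ℂ → ℂ} (hf : Differentiable ℂ f) {c : ℂ}
    {m : ℕ} (hm : (m : ℕ∞) ≤ analyticOrderAt f c) :
    ∃ F : ℂ → ℂ, Differentiable ℂ F ∧ ∀ z, f z = (z - c) ^ m * F z := by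
  have hfa : AnalyticAt ℂ f c := hf.analyticAt c
  obtain ⟨g, hg, hfg⟩ := (natCast_le_analyticOrderAt hfa).mp hm
  have hfc := hfg.self_of_nhds
  have hev : ∀ᶠ z in nhds c,
      Function.update (fun z => f z / (z - c) ^ m) c (g c) z = g z := by
    filter_upwards [hfg] with z hz
    rcases eq_or_ne z c with rfl | hzc
    · simp
    · rw [Function.update_of_ne hzc, hz, smul_eq_mul,
        mul_div_cancel_left₀ _ (pow_ne_zero _ (sub_ne_zero.mpr hzc))]
  refine ⟨Function.update (fun z => f z / (z - c) ^ m) c (g c), fun z => ?_, fun z => ?_⟩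
  · rcases eq_or_ne z c with rfl | hzc
    · exact hg.differentiableAt.congr_of_eventuallyEq hev
    · have h1 : DifferentiableAt ℂ (fun z => f z / (z - c) ^ m) z :=
        (hf z).div (by fun_prop) (pow_ne_zero _ (sub_ne_zero.mpr hzc))
      refine h1.congr_of_eventuallyEq ?_
      filter_upwards [isOpen_ne.mem_nhds hzc] with w hw
      rw [Function.update_of_ne hw]
  · rcases eq_or_ne z c with rfl | hzc
    · simpa using hfc
    · rw [Function.update_of_ne hzc, mul_div_cancel₀ _ (pow_ne_zero _ (sub_ne_zero.mpr hzc))]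

theorem le_exp_mul_of_le {x a b : ℝ} (hx : x ≤ a) {k : ℝ} (hk : Real.log (max a 1) ≤ k)
    (hb : 1 ≤ b) : x ≤ Real.exp (k * b) := by
  have h1 : a ≤ Real.exp (Real.log (max a 1)) := by
    rw [Real.exp_log (by positivity)]
    exact le_max_left _ _
  have h0 : 0 ≤ Real.log (max a 1) := Real.log_nonneg (le_max_right _ _)
  refine hx.trans (h1.trans (Real.exp_le_exp.mpr ?_))
  nlinarith

theorem norm_sub_le_of_isPrimitive {N : ℕ} [NeZero N] {χ : DirichletCharacter ℂ N} (hχ : χ ≠ 1)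
    (hp : χ.IsPrimitive) (hG : ∀ s : ℂ, 1 / 2 < s.re → DirichletCharacter.LFunction χ s ≠ 0)
    {m : ℕ} {F : ℂ → ℂ} (hF : Differentiable ℂ F)
    (hΛ : ∀ z, DirichletCharacter.completedLFunction χ z = (z - 1 / 2) ^ m * F z)
    {η : ℝ} (hη : 0 < η) (hη1 : η ≤ 1 / 4) {s : ℂ} (hs : 1 / 2 ≤ s.re) :
    ‖F (s - η)‖ ≤ (N : ℝ) ^ η * ‖F (s + η)‖ := by
  have hnorm : ∀ z, ‖DirichletCharacter.completedLFunction χ z‖ = ‖z - 1 / 2‖ ^ m * ‖F z‖ :=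
    fun z => by rw [hΛ, norm_mul, norm_pow]
  obtain ⟨C, hC, hgr⟩ := exists_completedLFunction_growth hχ hG hη (by linarith)
  obtain ⟨M, hM⟩ := exists_norm_completedLFunction_le hχ 0 4
  obtain ⟨M₁, hM₁⟩ := (isCompact_closedBall (1 / 2 : ℂ) 1).exists_bound_of_continuousOn
    hF.continuous.continuousOn
  obtain ⟨C₃, hC₃, hγ⟩ := exists_norm_gammaFactor_sub_le hη
  obtain ⟨C₂, hC₂, hL⟩ := exists_LFunction_bounds (show (1 : ℝ) < 3 / 2 by norm_num)
  set M' := max M M₁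
  set A := C₃ * C₂ * C₂ * 2 ^ m with hA
  have hFM : ∀ z : ℂ, 0 ≤ z.re → z.re ≤ 4 → ‖F z‖ ≤ M' := by
    intro z h0 h4
    rcases le_total ‖z - 1 / 2‖ 1 with h | h
    · exact (hM₁ z (mem_closedBall_iff_norm.mpr h)).trans (le_max_right _ _)
    · refine le_trans ?_ ((hM z h0 h4).trans (le_max_left _ _))
      rw [hnorm]
      exact le_mul_of_one_le_left (norm_nonneg _) (one_le_pow₀ h)
  have hright : ∀ z : ℂ, 7 / 4 ≤ z.re → ‖F (z - η)‖ ≤ A * ‖F (z + η)‖ := by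
    intro z hz
    have hre1 : (z - η).re = z.re - η := by simp
    have hre2 : (z + η).re = z.re + η := by simp
    have h1 : ‖DirichletCharacter.completedLFunction χ (z - η)‖ ≤
        C₃ * C₂ * C₂ * ‖DirichletCharacter.completedLFunction χ (z + η)‖ := by
      rw [completedLFunction_eq_gammaFactor_mul χ (by rw [hre1]; linarith),
        completedLFunction_eq_gammaFactor_mul χ (by rw [hre2]; linarith), norm_mul, norm_mul]
      have ha := hγ N χ z (by linarith)
      have hb := (hL N χ (z - η) (by rw [hre1]; linarith)).1
      have hc := (hL N χ (z + η) (by rw [hre2]; linarith)).2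
      rw [inv_le_iff_one_le_mul₀ hC₂] at hc
      have hn := norm_nonneg (DirichletCharacter.gammaFactor χ (z + η))
      calc _ ≤ (C₃ * ‖DirichletCharacter.gammaFactor χ (z + η)‖) * C₂ :=
            mul_le_mul ha hb (norm_nonneg _) (by positivity)
        _ ≤ (C₃ * ‖DirichletCharacter.gammaFactor χ (z + η)‖) * C₂ *
            (‖DirichletCharacter.LFunction χ (z + η)‖ * C₂) :=
            le_mul_of_one_le_right (by positivity) hc
        _ = _ := by ring
    have hpos : 1 ≤ ‖z - η - 1 / 2‖ := by
      have := (le_abs_self _).trans (Complex.abs_re_le_norm (z - η - 1 / 2))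
      rw [Complex.sub_re, hre1] at this
      norm_num at this
      linarith
    have hratio : ‖z + η - 1 / 2‖ ≤ 2 * ‖z - η - 1 / 2‖ := by
      have := norm_add_le (z - η - 1 / 2) ((2 * η : ℝ) : ℂ)
      rw [Complex.norm_real, Real.norm_of_nonneg (by positivity)] at this
      rw [show z - η - 1 / 2 + ((2 * η : ℝ) : ℂ) = z + η - 1 / 2 by push_cast; ring] at this
      linarith
    have hppos : 0 < ‖z - η - 1 / 2‖ ^ m := by positivity
    rw [hnorm, hnorm] at h1
    have h2 : ‖z + η - 1 / 2‖ ^ m ≤ 2 ^ m * ‖z - η - 1 / 2‖ ^ m := by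
      rw [← mul_pow]
      exact pow_le_pow_left₀ (norm_nonneg _) hratio m
    refine le_of_mul_le_mul_left ?_ hppos
    calc _ ≤ _ := h1
      _ ≤ C₃ * C₂ * C₂ * ((2 ^ m * ‖z - η - 1 / 2‖ ^ m) * ‖F (z + η)‖) := by gcongr
      _ = _ := by rw [hA]; ring
  refine norm_sub_le_mul_norm_add_of_line hF hη (K := (N : ℝ) ^ η) (A := A) (x₀ := 7 / 4)
    (B := Real.log (max M' 1) + C + m + Real.log (max A 1)) (fun z hz hFz => ?_) (fun z hz => ?_)
    (fun z hz => ?_) (fun x hx => hright x (by simpa using hx)) hs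
  · have h0 := hΛ z
    rw [hFz, mul_zero, completedLFunction_eq_gammaFactor_mul χ (by linarith)] at h0
    exact mul_ne_zero (gammaFactor_ne_zero χ (by linarith)) (hG z hz) h0
  · have h1 := norm_completedLFunction_one_sub hχ hp (1 - (z - η))
    have hconj : starRingEnd ℂ (1 - (z - η)) = z + η := by
      apply Complex.ext
      · simp [hz]
        ring
      · simp
    rw [hconj, sub_sub_cancel, hnorm, hnorm] at h1
    have hre : (1 - (z - (η : ℂ))).re - 1 / 2 = η := by
      simp [hz]
      ring
    have heq : ‖z - η - 1 / 2‖ = ‖z + η - 1 / 2‖ := by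
      rw [← RCLike.norm_conj, ← norm_neg]
      congr 1
      apply Complex.ext
      · simp [hz]
      · simp
    rw [hre, heq] at h1
    have hne : z + η - 1 / 2 ≠ 0 := by
      intro h
      have := congrArg Complex.re h
      simp [hz] at this
      exact hη.ne' this
    have hppos : 0 < ‖z + η - 1 / 2‖ ^ m := pow_pos (norm_pos_iff.mpr hne) m
    refine le_of_mul_le_mul_left ?_ hppos
    rw [h1]
    exact le_of_eq (by ring)
  · have hT : 1 ≤ 1 + ‖z - 1 / 2‖ := by linarith [norm_nonneg (z - 1 / 2)]
    have hm0 : (0 : ℝ) ≤ m := Nat.cast_nonneg m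
    have hM0 : 0 ≤ Real.log (max M' 1) := Real.log_nonneg (le_max_right _ _)
    have hA0 : 0 ≤ Real.log (max A 1) := Real.log_nonneg (le_max_right _ _)
    rcases le_total z.re (7 / 4) with h | h
    · have hre1 : (z - η).re = z.re - η := by simp
      have hre2 : (z + η).re = z.re + η := by simp
      have him : (z + η).im = z.im := by simp
      have h1 := hFM (z - η) (by rw [hre1]; linarith) (by rw [hre1]; linarith)
      have h2 := (hgr (z + η) (by rw [hre2]; linarith) (by rw [hre2]; linarith)).2
      rw [hnorm, him] at h2
      have himle : |z.im| ≤ ‖z - 1 / 2‖ := by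
        have := Complex.abs_im_le_norm (z - 1 / 2)
        simpa using this
      have hx : ‖z + η - 1 / 2‖ ≤ 1 + ‖z - 1 / 2‖ := by
        have := norm_add_le (z - 1 / 2) (η : ℂ)
        rw [Complex.norm_real, Real.norm_of_nonneg hη.le,
          show z - 1 / 2 + (η : ℂ) = z + η - 1 / 2 by ring] at this
        linarith
      have hxm : ‖z + η - 1 / 2‖ ^ m ≤ Real.exp (m * (1 + ‖z - 1 / 2‖)) := by
        rw [Real.exp_nat_mul]
        refine pow_le_pow_left₀ (norm_nonneg _) (hx.trans ?_) m
        linarith [Real.add_one_le_exp (1 + ‖z - 1 / 2‖)]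
      have h3 : Real.exp (-(C * (1 + ‖z - 1 / 2‖))) ≤
          Real.exp (m * (1 + ‖z - 1 / 2‖)) * ‖F (z + η)‖ := by
        refine le_trans ?_ (h2.trans (mul_le_mul_of_nonneg_right hxm (norm_nonneg _)))
        refine Real.exp_le_exp.mpr ?_
        nlinarith
      have h4 : 1 ≤ Real.exp ((C + m) * (1 + ‖z - 1 / 2‖)) * ‖F (z + η)‖ := by
        calc (1 : ℝ) = Real.exp (C * (1 + ‖z - 1 / 2‖)) *
              Real.exp (-(C * (1 + ‖z - 1 / 2‖))) := by
              rw [← Real.exp_add, add_neg_cancel, Real.exp_zero]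
          _ ≤ Real.exp (C * (1 + ‖z - 1 / 2‖)) *
              (Real.exp (m * (1 + ‖z - 1 / 2‖)) * ‖F (z + η)‖) :=
              mul_le_mul_of_nonneg_left h3 (Real.exp_pos _).le
          _ = _ := by rw [add_mul, Real.exp_add, mul_assoc]
      calc ‖F (z - η)‖ ≤ Real.exp ((Real.log (max M' 1) + Real.log (max A 1)) *
            (1 + ‖z - 1 / 2‖)) * 1 := by
            rw [mul_one]
            exact le_exp_mul_of_le h1 (by linarith) hT
        _ ≤ Real.exp ((Real.log (max M' 1) + Real.log (max A 1)) * (1 + ‖z - 1 / 2‖)) *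
            (Real.exp ((C + m) * (1 + ‖z - 1 / 2‖)) * ‖F (z + η)‖) :=
            mul_le_mul_of_nonneg_left h4 (Real.exp_pos _).le
        _ = _ := by
            rw [← mul_assoc, ← Real.exp_add]
            ring_nf
    · refine (hright z h).trans (mul_le_mul_of_nonneg_right ?_ (norm_nonneg _))
      exact le_exp_mul_of_le le_rfl (by linarith) hT

theorem mul_re_inv_le_of_isPrimitive {N : ℕ} [NeZero N] {χ : DirichletCharacter ℂ N} (hχ : χ ≠ 1)
    (hp : χ.IsPrimitive) (hG : ∀ s : ℂ, 1 / 2 < s.re → DirichletCharacter.LFunction χ s ≠ 0)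
    {m : ℕ} (hm : (m : ℕ∞) ≤ analyticOrderAt (DirichletCharacter.completedLFunction χ) (1 / 2))
    {s : ℂ} (hs : 1 / 2 < s.re) :
    m * (1 / (s - 1 / 2)).re ≤ 1 / 2 * Real.log N +
      (deriv (DirichletCharacter.completedLFunction χ) s /
        DirichletCharacter.completedLFunction χ s).re := by
  obtain ⟨F, hF, hΛ⟩ := exists_eq_pow_mul_of_le_analyticOrderAt
    (DirichletCharacter.differentiable_completedLFunction hχ) hm
  have hNpos : (0 : ℝ) < N := by exact_mod_cast Nat.pos_of_ne_zero (NeZero.ne N)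
  have hΛ0 : DirichletCharacter.completedLFunction χ s ≠ 0 := by
    rw [completedLFunction_eq_gammaFactor_mul χ (by linarith)]
    exact mul_ne_zero (gammaFactor_ne_zero χ (by linarith)) (hG s hs)
  have hF0 : F s ≠ 0 := by
    intro h
    rw [hΛ, h, mul_zero] at hΛ0
    exact hΛ0 rfl
  have hs0 : s - 1 / 2 ≠ 0 := by
    intro h
    have := congrArg Complex.re h
    simp at this
    norm_num at hs this
    linarith
  have hpos := re_logDeriv_nonneg_of_norm_sub_le hF hNpos hF0 (by
    have : Set.Ioo (0 : ℝ) (1 / 4) ∈ nhdsWithin 0 (Set.Ioi 0) := Ioo_mem_nhdsGT (by norm_num)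
    filter_upwards [this] with η hη
    exact norm_sub_le_of_isPrimitive hχ hp hG hF hΛ hη.1 hη.2.le hs.le)
  have hlog : deriv (DirichletCharacter.completedLFunction χ) s /
      DirichletCharacter.completedLFunction χ s = m * (1 / (s - 1 / 2)) + deriv F s / F s := by
    have hfun : DirichletCharacter.completedLFunction χ = fun z => (z - 1 / 2) ^ m * F z :=
      funext hΛ
    have h1 := logDeriv_mul (f := fun z : ℂ => (z - 1 / 2) ^ m) (g := F) s
      (pow_ne_zero _ hs0) hF0 (by fun_prop) (hF s)
    have h2 := logDeriv_fun_pow (f := fun z : ℂ => z - 1 / 2) (x := s) (by fun_prop) m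
    rw [h2] at h1
    simp only [logDeriv_apply] at h1
    rw [hfun]
    refine h1.trans ?_
    congr 2
    rw [deriv_sub_const]
    simp
  rw [hlog, Complex.add_re]
  have : ((m : ℂ) * (1 / (s - 1 / 2))).re = m * (1 / (s - 1 / 2)).re := by
    rw [show (m : ℂ) = ((m : ℝ) : ℂ) by norm_cast, Complex.re_ofReal_mul]
  rw [this]
  linarith

theorem ordAt_le_analyticOrderAt {f : ℂ → ℂ} {z : ℂ} (hf : AnalyticAt ℂ f z) :
    (ordAt f z : ℕ∞) ≤ analyticOrderAt f z := by
  rw [natCast_le_analyticOrderAt_iff_iteratedDeriv_eq_zero hf]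
  intro i hi
  by_contra h
  exact Nat.notMem_of_lt_sInf hi h

theorem Lfunc_eq_LFunction {q : ℕ} [NeZero q] (χ : DirichletCharacter ℂ q) :
    Lfunc q χ = DirichletCharacter.LFunction χ := by
  funext s
  simp [Lfunc, NeZero.ne q]

theorem LFunction_ne_zero_of_GRHchi {q : ℕ} [NeZero q] {χ : DirichletCharacter ℂ q} (hχ : χ ≠ 1)
    (hG : GRHchi χ) {s : ℂ} (hs : 1 / 2 < s.re) : DirichletCharacter.LFunction χ s ≠ 0 := by
  intro h
  rcases lt_or_ge s.re 1 with h1 | h1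
  · have := hG s (by linarith) h1 (by rw [Lfunc_eq_LFunction, h])
    linarith
  · exact DirichletCharacter.LFunction_ne_zero_of_one_le_re χ (.inl hχ) h1 h

theorem norm_eulerTerm_le {N : ℕ} (χ : DirichletCharacter ℂ N) {p : ℕ} (hp : p.Prime) {s : ℂ}
    (hs : 1 / 2 ≤ s.re) : ‖χ p * (p : ℂ) ^ (-s)‖ ≤ (√p)⁻¹ := by
  have hp0 : (0 : ℝ) < p := by exact_mod_cast hp.pos
  have hp1 : (1 : ℝ) ≤ p := by exact_mod_cast hp.one_lt.le
  rw [norm_mul, Complex.norm_natCast_cpow_of_pos hp.pos, Real.sqrt_eq_rpow,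
    ← Real.rpow_neg hp0.le]
  calc ‖χ p‖ * (p : ℝ) ^ (-s).re ≤ 1 * (p : ℝ) ^ (-s).re :=
        mul_le_mul_of_nonneg_right (χ.norm_le_one _) (by positivity)
    _ ≤ _ := by
        rw [one_mul]
        refine Real.rpow_le_rpow_of_exponent_le hp1 ?_
        rw [Complex.neg_re]
        linarith

theorem one_lt_sqrt_prime {p : ℕ} (hp : p.Prime) : 1 < √(p : ℝ) := by
  rw [Real.lt_sqrt zero_le_one]
  exact_mod_cast by simpa using hp.one_lt

theorem eulerFactor_ne_zero {N : ℕ} (χ : DirichletCharacter ℂ N) {p : ℕ} (hp : p.Prime) {s : ℂ}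
    (hs : 1 / 2 ≤ s.re) : 1 - χ p * (p : ℂ) ^ (-s) ≠ 0 := by
  intro h
  have h1 := norm_eulerTerm_le χ hp hs
  rw [← sub_eq_zero.mp h, norm_one] at h1
  exact absurd h1 (not_le.mpr (inv_lt_one_of_one_lt₀ (one_lt_sqrt_prime hp)))

theorem differentiable_eulerFactor {N : ℕ} (χ : DirichletCharacter ℂ N) {p : ℕ} (hp : p.Prime) :
    Differentiable ℂ fun s : ℂ => 1 - χ p * (p : ℂ) ^ (-s) := by
  have hp0 : (p : ℂ) ≠ 0 := by exact_mod_cast hp.ne_zero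
  intro s
  exact (differentiableAt_const _).sub ((differentiableAt_id.neg.const_cpow (.inl hp0)).const_mul _)

theorem norm_logDeriv_eulerFactor_le {N : ℕ} (χ : DirichletCharacter ℂ N) {p : ℕ} (hp : p.Prime)
    {s : ℂ} (hs : 1 / 2 ≤ s.re) :
    ‖logDeriv (fun s : ℂ => 1 - χ p * (p : ℂ) ^ (-s)) s‖ ≤ Real.log p / (√p - 1) := by
  have hp0 : (p : ℂ) ≠ 0 := by exact_mod_cast hp.ne_zero
  have hp1 : (1 : ℝ) ≤ p := by exact_mod_cast hp.one_lt.le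
  have hd : HasDerivAt (fun s : ℂ => 1 - χ p * (p : ℂ) ^ (-s))
      (Complex.log p * (χ p * (p : ℂ) ^ (-s))) s := by
    have := (((hasDerivAt_neg s).const_cpow (c := (p : ℂ)) (.inl hp0)).const_mul (χ p)).const_sub 1
    refine this.congr_deriv ?_
    ring
  have h1 := norm_eulerTerm_le χ hp hs
  have h2 : 1 - (√(p : ℝ))⁻¹ ≤ ‖1 - χ p * (p : ℂ) ^ (-s)‖ := by
    have := norm_sub_norm_le (1 : ℂ) (χ p * (p : ℂ) ^ (-s))
    rw [norm_one] at this
    linarith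
  have h3 := one_lt_sqrt_prime hp
  have h4 : (√(p : ℝ))⁻¹ < 1 := inv_lt_one_of_one_lt₀ h3
  have hlog : ‖Complex.log p‖ = Real.log p := by
    rw [Complex.natCast_log.symm, Complex.norm_real, Real.norm_of_nonneg (Real.log_nonneg hp1)]
  rw [logDeriv_apply, hd.deriv, norm_div, norm_mul, hlog]
  calc _ ≤ Real.log p * (√(p : ℝ))⁻¹ / (1 - (√(p : ℝ))⁻¹) := by
        have := Real.log_nonneg hp1
        gcongr
    _ = _ := by
        have : √(p : ℝ) ≠ 0 := by linarith
        have : √(p : ℝ) - 1 ≠ 0 := by linarith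
        field_simp

theorem logDeriv_LFunction_changeLevel {M N : ℕ} [NeZero M] [NeZero N] (h : M ∣ N)
    {χ : DirichletCharacter ℂ M} (hχ : χ ≠ 1) {s : ℂ} (hs : 1 / 2 ≤ s.re)
    (h0 : DirichletCharacter.LFunction χ s ≠ 0) :
    logDeriv (DirichletCharacter.LFunction (DirichletCharacter.changeLevel h χ)) s =
      logDeriv (DirichletCharacter.LFunction χ) s +
        ∑ p ∈ N.primeFactors, logDeriv (fun s : ℂ => 1 - χ p * (p : ℂ) ^ (-s)) s := by
  have hf : DirichletCharacter.LFunction (DirichletCharacter.changeLevel h χ) =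
      fun s => DirichletCharacter.LFunction χ s *
        ∏ p ∈ N.primeFactors, (1 - χ p * (p : ℂ) ^ (-s)) :=
    funext fun s => DirichletCharacter.LFunction_changeLevel h χ (.inl hχ)
  have hprime : ∀ p ∈ N.primeFactors, p.Prime := fun p hp => Nat.prime_of_mem_primeFactors hp
  rw [hf, logDeriv_mul s h0 (Finset.prod_ne_zero_iff.mpr fun p hp =>
      eulerFactor_ne_zero χ (hprime p hp) hs) (DirichletCharacter.differentiable_LFunction hχ s)
      (DifferentiableAt.fun_finsetProd fun p hp => differentiable_eulerFactor χ (hprime p hp) s)]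
  congr 1
  exact logDeriv_prod (fun p hp => eulerFactor_ne_zero χ (hprime p hp) hs)
    (fun p hp => differentiable_eulerFactor χ (hprime p hp) s)

theorem analyticOrderAt_LFunction_changeLevel {M N : ℕ} [NeZero M] [NeZero N] (h : M ∣ N)
    {χ : DirichletCharacter ℂ M} (hχ : χ ≠ 1) {s : ℂ} (hs : 1 / 2 ≤ s.re) :
    analyticOrderAt (DirichletCharacter.LFunction (DirichletCharacter.changeLevel h χ)) s =
      analyticOrderAt (DirichletCharacter.LFunction χ) s := by
  have hf : DirichletCharacter.LFunction (DirichletCharacter.changeLevel h χ) =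
      DirichletCharacter.LFunction χ *
        fun s : ℂ => ∏ p ∈ N.primeFactors, (1 - χ p * (p : ℂ) ^ (-s)) :=
    funext fun s => DirichletCharacter.LFunction_changeLevel h χ (.inl hχ)
  have hprime : ∀ p ∈ N.primeFactors, p.Prime := fun p hp => Nat.prime_of_mem_primeFactors hp
  have hd : Differentiable ℂ fun s : ℂ => ∏ p ∈ N.primeFactors, (1 - χ p * (p : ℂ) ^ (-s)) :=
    Differentiable.fun_finsetProd fun p hp => differentiable_eulerFactor χ (hprime p hp)
  rw [hf, analyticOrderAt_mul
    ((DirichletCharacter.differentiable_LFunction hχ).analyticAt s) (hd.analyticAt s),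
    (hd.analyticAt s).analyticOrderAt_eq_zero.mpr (Finset.prod_ne_zero_iff.mpr fun p hp =>
      eulerFactor_ne_zero χ (hprime p hp) hs), add_zero]

theorem completedLFunction_eventuallyEq {N : ℕ} [NeZero N] (χ : DirichletCharacter ℂ N) {s : ℂ}
    (hs : 0 < s.re) : DirichletCharacter.completedLFunction χ =ᶠ[nhds s]
      DirichletCharacter.gammaFactor χ * DirichletCharacter.LFunction χ := by
  filter_upwards [(isOpen_lt continuous_const Complex.continuous_re).mem_nhds hs] with z hz
  exact completedLFunction_eq_gammaFactor_mul χ hz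

theorem analyticAt_gammaFactor {N : ℕ} (χ : DirichletCharacter ℂ N) {s : ℂ}
    (hs : 0 < s.re) : AnalyticAt ℂ (DirichletCharacter.gammaFactor χ) s := by
  have ho := (isOpen_lt (continuous_const (y := (0 : ℝ))) Complex.continuous_re)
  exact DifferentiableOn.analyticAt (s := {z : ℂ | 0 < z.re})
    (fun z hz => (differentiableAt_gammaFactor χ hz).differentiableWithinAt) (ho.mem_nhds hs)

theorem analyticOrderAt_completedLFunction {N : ℕ} [NeZero N] {χ : DirichletCharacter ℂ N}
    (hχ : χ ≠ 1) {s : ℂ} (hs : 0 < s.re) :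
    analyticOrderAt (DirichletCharacter.completedLFunction χ) s =
      analyticOrderAt (DirichletCharacter.LFunction χ) s := by
  rw [analyticOrderAt_congr (completedLFunction_eventuallyEq χ hs),
    analyticOrderAt_mul (analyticAt_gammaFactor χ hs)
      ((DirichletCharacter.differentiable_LFunction hχ).analyticAt s),
    (analyticAt_gammaFactor χ hs).analyticOrderAt_eq_zero.mpr (gammaFactor_ne_zero χ hs), zero_add]

theorem logDeriv_completedLFunction {N : ℕ} [NeZero N] {χ : DirichletCharacter ℂ N}
    (hχ : χ ≠ 1) {s : ℂ} (hs : 0 < s.re) (h0 : DirichletCharacter.LFunction χ s ≠ 0) :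
    logDeriv (DirichletCharacter.completedLFunction χ) s =
      logDeriv (DirichletCharacter.gammaFactor χ) s +
        logDeriv (DirichletCharacter.LFunction χ) s := by
  have h := completedLFunction_eventuallyEq χ hs
  rw [logDeriv_apply, h.deriv_eq, h.eq_of_nhds, ← logDeriv_apply]
  exact logDeriv_mul s (gammaFactor_ne_zero χ hs) h0 (differentiableAt_gammaFactor χ hs)
    (DirichletCharacter.differentiable_LFunction hχ s)

theorem exists_ordAt_mul_re_inv_le : ∃ C > 0, ∀ (q : ℕ) [NeZero q] (χ : DirichletCharacter ℂ q),
    χ ≠ 1 → GRHchi χ → ∀ s : ℂ, 1 / 2 < s.re → s.re ≤ 2 →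
    (ordAt (Lfunc q χ) (1 / 2) : ℝ) * (1 / (s - 1 / 2)).re ≤
      1 / 2 * Real.log q + ∑ p ∈ q.primeFactors, Real.log p / (√p - 1) + C * (1 + |s.im|) +
        (logDeriv (DirichletCharacter.LFunction χ) s).re := by
  obtain ⟨C, hC, hb⟩ := exists_gammaFactor_strip_bounds
  refine ⟨C, hC, fun q _ χ hχ hG s hs hs2 => ?_⟩
  have : NeZero χ.conductor := ⟨χ.conductor_ne_zero⟩
  set ψ := χ.primitiveCharacter with hψdef
  have hd := χ.conductor_dvd_level
  have hcl : DirichletCharacter.changeLevel hd ψ = χ := χ.changeLevel_primitiveCharacter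
  have hψ : ψ ≠ 1 := by
    intro h
    rw [h, DirichletCharacter.changeLevel_one] at hcl
    exact hχ hcl.symm
  have hψ0 : ∀ s : ℂ, 1 / 2 < s.re → DirichletCharacter.LFunction ψ s ≠ 0 := by
    intro s hs h
    have := LFunction_ne_zero_of_GRHchi hχ hG hs
    rw [← hcl, DirichletCharacter.LFunction_changeLevel hd ψ (.inl hψ), h, zero_mul] at this
    exact this rfl
  have hm : (ordAt (Lfunc q χ) (1 / 2) : ℕ∞) ≤
      analyticOrderAt (DirichletCharacter.completedLFunction ψ) (1 / 2) := by
    rw [Lfunc_eq_LFunction, analyticOrderAt_completedLFunction hψ (by norm_num),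
      ← analyticOrderAt_LFunction_changeLevel hd hψ (by norm_num), hcl]
    exact ordAt_le_analyticOrderAt ((DirichletCharacter.differentiable_LFunction hχ).analyticAt _)
  have h1 := mul_re_inv_le_of_isPrimitive hψ χ.primitiveCharacter_isPrimitive hψ0 hm hs
  rw [← logDeriv_apply, logDeriv_completedLFunction hψ (by linarith) (hψ0 s hs)] at h1
  have h2 := logDeriv_LFunction_changeLevel hd hψ hs.le (hψ0 s hs)
  rw [hcl] at h2
  have h3 : ‖∑ p ∈ q.primeFactors, logDeriv (fun s : ℂ => 1 - ψ p * (p : ℂ) ^ (-s)) s‖ ≤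
      ∑ p ∈ q.primeFactors, Real.log p / (√p - 1) :=
    norm_sum_le_of_le _ fun p hp =>
      norm_logDeriv_eulerFactor_le ψ (Nat.prime_of_mem_primeFactors hp) hs.le
  have h4 := (hb χ.conductor ψ s hs.le hs2).1
  rw [← logDeriv_apply] at h4
  have h5 : Real.log χ.conductor ≤ Real.log q := by
    have hc0 := Nat.pos_of_ne_zero χ.conductor_ne_zero
    refine Real.log_le_log (by exact_mod_cast hc0) ?_
    exact_mod_cast Nat.le_of_dvd (Nat.pos_of_ne_zero (NeZero.ne q)) hd
  have h6 := congrArg Complex.re h2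
  rw [Complex.add_re] at h1 h6
  have h7 := (Complex.abs_re_le_norm _).trans h3
  have h8 := (Complex.abs_re_le_norm _).trans h4
  rw [abs_le] at h7 h8
  linarith [h7.1, h8.2]

theorem exists_norm_logDeriv_LFunction_le {q : ℕ} [NeZero q] {χ : DirichletCharacter ℂ q}
    (hχ : χ ≠ 1) (hG : GRHchi χ) {δ : ℝ} (hδ : 0 < δ) (hδ1 : δ ≤ 1) :
    ∃ C > 0, ∀ s : ℂ, 1 / 2 + δ ≤ s.re → s.re ≤ 2 →
      ‖logDeriv (DirichletCharacter.LFunction χ) s‖ ≤ C * (1 + |s.im|) := by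
  obtain ⟨C, hC, hb⟩ := exists_gammaFactor_strip_bounds
  have hne : ∀ s : ℂ, 1 / 2 < s.re → DirichletCharacter.LFunction χ s ≠ 0 :=
    fun s hs => LFunction_ne_zero_of_GRHchi hχ hG hs
  obtain ⟨C', hC', hb'⟩ := exists_completedLFunction_growth hχ hne hδ hδ1
  refine ⟨C' + C, by positivity, fun s hs hs2 => ?_⟩
  have h1 := (hb' s hs hs2).1
  have h2 := (hb q χ s (by linarith) hs2).1
  rw [← logDeriv_apply] at h1 h2
  have h3 := logDeriv_completedLFunction hχ (s := s) (by linarith) (hne s (by linarith))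
  rw [eq_sub_of_add_eq' h3.symm]
  refine (norm_sub_le _ _).trans ?_
  linarith

theorem LSeries_residueClass_one_bound {q : ℕ} [NeZero q] {η : ℝ} (hη : 0 < η) {s : ℂ}
    (hs : 1 + η ≤ s.re) :
    ‖LSeries (fun n => (ArithmeticFunction.vonMangoldt.residueClass (1 : ZMod q) n : ℂ)) s‖ ≤
      2 / η * (∑' k : ℕ, ((k : ℝ) + 1) ^ (-1 - η / 2)) * (q : ℝ)⁻¹ := by
  set f : ℕ → ℂ := LSeries.term
    (fun n => (ArithmeticFunction.vonMangoldt.residueClass (1 : ZMod q) n : ℂ)) s with hf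
  have hq : 0 < q := Nat.pos_of_ne_zero (NeZero.ne q)
  have hq1 : (1 : ℝ) ≤ q := by exact_mod_cast hq
  set g : ℕ → ℕ := fun k => 1 + (k + 1) * q with hg
  have hinj : Function.Injective g := by
    intro a b hab
    have : (a + 1) * q = (b + 1) * q := by simpa [hg] using hab
    have := Nat.eq_of_mul_eq_mul_right hq this
    omega
  have hsupp : Function.support f ⊆ Set.range g := by
    intro n hn
    have hn0 : n ≠ 0 := by
      rintro rfl
      exact hn (LSeries.term_zero _ _)
    have hres : ArithmeticFunction.vonMangoldt.residueClass (1 : ZMod q) n ≠ 0 := by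
      intro h
      apply hn
      simp [hf, LSeries.term_def, h]
    have hmem : (n : ZMod q) = 1 := by
      by_contra hne
      exact hres (Set.indicator_of_notMem (by exact hne) _)
    have hΛ : ArithmeticFunction.vonMangoldt n ≠ 0 := by
      intro h
      exact hres (le_antisymm ((ArithmeticFunction.vonMangoldt.residueClass_le _ _).trans h.le)
        (ArithmeticFunction.vonMangoldt.residueClass_nonneg _ _))
    have hn1 : n ≠ 1 := by
      rintro rfl
      simp at hΛ
    have hd : q ∣ n - 1 := by
      rw [← ZMod.natCast_eq_zero_iff, Nat.cast_sub (by omega), hmem]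
      simp
    obtain ⟨k, hk⟩ := hd
    have hk0 : k ≠ 0 := by
      rintro rfl
      omega
    refine ⟨k - 1, ?_⟩
    simp only [hg]
    rw [Nat.sub_add_cancel (Nat.one_le_iff_ne_zero.mpr hk0), mul_comm, ← hk]
    omega
  have hsum : Summable fun k : ℕ => ((k : ℝ) + 1) ^ (-1 - η / 2) := by
    have := (summable_nat_add_iff 1).mpr
      (Real.summable_nat_rpow (p := -1 - η / 2) |>.mpr (by linarith))
    simpa using this
  rw [LSeries, ← hf, ← hinj.tsum_eq hsupp]
  have hb := ((hsum.hasSum.mul_left (2 / η)).mul_right (q : ℝ)⁻¹)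
  refine tsum_of_norm_bounded hb fun k => ?_
  have hk0 : (0 : ℝ) < (k : ℝ) + 1 := by positivity
  have hx : ((k : ℝ) + 1) * q ≤ (g k : ℕ) := by
    simp only [hg]
    push_cast
    linarith
  have hgk : (1 : ℝ) ≤ (g k : ℕ) := by
    refine le_trans ?_ hx
    nlinarith
  have hg0 : (0 : ℝ) < (g k : ℕ) := by linarith
  have hgn : g k ≠ 0 := by simp [hg]
  rw [hf, LSeries.term_of_ne_zero hgn, norm_div, Complex.norm_real,
    Complex.norm_natCast_cpow_of_pos (Nat.pos_of_ne_zero hgn),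
    Real.norm_of_nonneg (ArithmeticFunction.vonMangoldt.residueClass_nonneg _ _)]
  have h1 : ArithmeticFunction.vonMangoldt.residueClass (1 : ZMod q) (g k) ≤
      ((g k : ℕ) : ℝ) ^ (η / 2) / (η / 2) :=
    (ArithmeticFunction.vonMangoldt.residueClass_le _ _).trans
      (ArithmeticFunction.vonMangoldt_le_log.trans
        (Real.log_le_rpow_div hg0.le (by positivity)))
  have h2 : ((g k : ℕ) : ℝ) ^ (1 + η) ≤ ((g k : ℕ) : ℝ) ^ s.re :=
    Real.rpow_le_rpow_of_exponent_le hgk hs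
  calc _ ≤ ((g k : ℕ) : ℝ) ^ (η / 2) / (η / 2) / ((g k : ℕ) : ℝ) ^ (1 + η) := by
        gcongr
    _ = 2 / η * ((g k : ℕ) : ℝ) ^ (-1 - η / 2) := by
        rw [show -1 - η / 2 = η / 2 - (1 + η) by ring, Real.rpow_sub hg0]
        field_simp
    _ ≤ 2 / η * (((k : ℝ) + 1) * q) ^ (-1 - η / 2) := by
        refine mul_le_mul_of_nonneg_left ?_ (by positivity)
        exact Real.rpow_le_rpow_of_nonpos (by positivity) hx (by linarith)
    _ = 2 / η * ((k : ℝ) + 1) ^ (-1 - η / 2) * (q : ℝ) ^ (-1 - η / 2) := by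
        rw [Real.mul_rpow hk0.le (by positivity), mul_assoc]
    _ ≤ 2 / η * ((k : ℝ) + 1) ^ (-1 - η / 2) * (q : ℝ)⁻¹ := by
        rw [← Real.rpow_neg_one (q : ℝ)]
        refine mul_le_mul_of_nonneg_left ?_ (by positivity)
        exact Real.rpow_le_rpow_of_exponent_le hq1 (by linarith)

theorem exists_norm_logDeriv_LFunction_le_of_one_lt {σ : ℝ} (hσ : 1 < σ) :
    ∃ C > 0, ∀ (q : ℕ) [NeZero q] (χ : DirichletCharacter ℂ q), ∀ s : ℂ, σ ≤ s.re →
      ‖logDeriv (DirichletCharacter.LFunction χ) s‖ ≤ C := by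
  have hsum : Summable fun n => ‖LSeries.term
      (fun n => (ArithmeticFunction.vonMangoldt n : ℂ)) (σ : ℂ) n‖ :=
    (ArithmeticFunction.LSeriesSummable_vonMangoldt (by simpa using hσ)).norm
  refine ⟨∑' n, ‖LSeries.term (fun n => (ArithmeticFunction.vonMangoldt n : ℂ)) (σ : ℂ) n‖ + 1,
    add_pos_of_nonneg_of_pos (tsum_nonneg fun _ => norm_nonneg _) one_pos, ?_⟩
  intro q _ χ s hs
  have h1 := DirichletCharacter.LSeries_twist_vonMangoldt_eq χ (s := s) (by linarith)
  rw [← DirichletCharacter.LFunction_eq_LSeries χ (by linarith),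
    ← DirichletCharacter.deriv_LFunction_eq_deriv_LSeries χ (by linarith), neg_div] at h1
  rw [logDeriv_apply, ← norm_neg, ← h1]
  refine le_trans (tsum_of_norm_bounded hsum.hasSum fun n => ?_) (by linarith)
  rcases eq_or_ne n 0 with rfl | hn
  · simp
  have hn1 : (1 : ℝ) ≤ n := by exact_mod_cast Nat.one_le_iff_ne_zero.mpr hn
  rw [LSeries.term_of_ne_zero hn, LSeries.term_of_ne_zero hn, norm_div, norm_div,
    Complex.norm_natCast_cpow_of_pos (Nat.pos_of_ne_zero hn),
    Complex.norm_natCast_cpow_of_pos (Nat.pos_of_ne_zero hn), Complex.ofReal_re, Pi.mul_apply,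
    norm_mul]
  have h2 : (n : ℝ) ^ σ ≤ (n : ℝ) ^ s.re := Real.rpow_le_rpow_of_exponent_le hn1 hs
  have h3 := χ.norm_le_one (n : ZMod q)
  gcongr
  exact mul_le_of_le_one_left (norm_nonneg _) h3

theorem exists_norm_sum_logDeriv_le {η : ℝ} (hη : 0 < η) :
    ∃ C > 0, ∀ (q : ℕ) [NeZero q], ∀ s : ℂ, 1 + η ≤ s.re →
      ‖∑ χ ∈ (Finset.univ : Finset (DirichletCharacter ℂ q)).erase 1,
        logDeriv (DirichletCharacter.LFunction χ) s‖ ≤ C := by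
  obtain ⟨C, hC, hb⟩ := exists_norm_logDeriv_LFunction_le_of_one_lt (σ := 1 + η) (by linarith)
  refine ⟨2 / η * (∑' k : ℕ, ((k : ℝ) + 1) ^ (-1 - η / 2)) + C, ?_, fun q _ s hs => ?_⟩
  · have : 0 ≤ ∑' k : ℕ, ((k : ℝ) + 1) ^ (-1 - η / 2) := tsum_nonneg fun k => by positivity
    positivity
  have hφ0 : (q.totient : ℂ) ≠ 0 := by
    exact_mod_cast (Nat.totient_pos.mpr (Nat.pos_of_ne_zero (NeZero.ne q))).ne'
  have hq0 : (0 : ℝ) < q := by exact_mod_cast Nat.pos_of_ne_zero (NeZero.ne q)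
  have h1 := ArithmeticFunction.vonMangoldt.LSeries_residueClass_eq
    (isUnit_one (M := ZMod q)) (s := s) (by linarith)
  have h2 : ∑ χ : DirichletCharacter ℂ q, logDeriv (DirichletCharacter.LFunction χ) s =
      -(q.totient : ℂ) *
        LSeries (fun n => (ArithmeticFunction.vonMangoldt.residueClass (1 : ZMod q) n : ℂ)) s := by
    rw [h1, ← mul_assoc, neg_mul_neg, mul_inv_cancel₀ hφ0, one_mul]
    refine Finset.sum_congr rfl fun χ _ => ?_
    simp [logDeriv_apply]
  rw [Finset.sum_erase_eq_sub (Finset.mem_univ _), h2]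
  refine (norm_sub_le _ _).trans (add_le_add ?_ (hb q 1 s hs))
  rw [norm_mul, norm_neg, Complex.norm_natCast]
  have h3 := LSeries_residueClass_one_bound (q := q) hη hs
  have h4 : (q.totient : ℝ) ≤ q := by exact_mod_cast Nat.totient_le q
  calc _ ≤ (q : ℝ) * (2 / η * (∑' k : ℕ, ((k : ℝ) + 1) ^ (-1 - η / 2)) * (q : ℝ)⁻¹) := by
        gcongr
    _ = _ := by field_simp

theorem sum_exp_neg_mul_sq_succ_le {b : ℝ} (hb : 0 < b) (n : ℕ) :
    ∑ i ∈ Finset.range n, Real.exp (-b * ((i : ℝ) + 1) ^ 2) ≤ √(π / b) / 2 := by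
  have hanti : AntitoneOn (fun x : ℝ => Real.exp (-b * x ^ 2)) (Set.Icc 0 (0 + (n : ℕ))) := by
    intro x hx y hy hxy
    refine Real.exp_le_exp.mpr ?_
    have : x ^ 2 ≤ y ^ 2 := pow_le_pow_left₀ hx.1 hxy 2
    nlinarith
  have h1 := hanti.sum_le_integral
  simp only [zero_add, Nat.cast_add, Nat.cast_one] at h1
  refine h1.trans ?_
  rw [intervalIntegral.integral_of_le (by positivity), ← integral_gaussian_Ioi]
  exact MeasureTheory.setIntegral_mono_set (integrable_exp_neg_mul_sq hb).integrableOn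
    (Filter.Eventually.of_forall fun x => (Real.exp_pos _).le)
    (Set.Ioc_subset_Ioi_self.eventuallyLE)

theorem sum_exp_neg_mul_sub_sq_le {b : ℝ} (hb : 0 < b) (J j : ℕ) :
    ∑ k ∈ Finset.range J, Real.exp (-b * ((j : ℝ) - k) ^ 2) ≤ 1 + √(π / b) := by
  calc _ ≤ ∑ k ∈ Finset.range (j + J), Real.exp (-b * ((j : ℝ) - k) ^ 2) :=
        Finset.sum_le_sum_of_subset_of_nonneg (Finset.range_mono (by omega))
          fun _ _ _ => (Real.exp_pos _).le
    _ = ∑ k ∈ Finset.range j, Real.exp (-b * ((j : ℝ) - k) ^ 2) +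
        ∑ i ∈ Finset.range J, Real.exp (-b * ((j : ℝ) - (j + i : ℕ)) ^ 2) :=
        Finset.sum_range_add _ _ _
    _ ≤ √(π / b) / 2 + (1 + √(π / b) / 2) := by
        refine add_le_add ?_ ?_
        · rw [← Finset.sum_range_reflect]
          refine le_trans (Finset.sum_le_sum fun i hi => ?_) (sum_exp_neg_mul_sq_succ_le hb j)
          have hij := Finset.mem_range.mp hi
          refine le_of_eq ?_
          rw [Nat.sub_sub, Nat.cast_sub (by omega)]
          push_cast
          ring_nf
        · calc _ ≤ ∑ i ∈ Finset.range (J + 1), Real.exp (-b * (i : ℝ) ^ 2) := by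
                refine le_trans (le_of_eq (Finset.sum_congr rfl fun i _ => ?_))
                  (Finset.sum_le_sum_of_subset_of_nonneg (Finset.range_mono (Nat.le_succ J))
                    fun _ _ _ => (Real.exp_pos _).le)
                push_cast
                ring_nf
            _ = _ := Finset.sum_range_succ' _ _
            _ ≤ _ := by
                have := sum_exp_neg_mul_sq_succ_le hb J
                push_cast
                simp only [ne_eq, OfNat.ofNat_ne_zero, not_false_eq_true, zero_pow, mul_zero,
                  Real.exp_zero]
                linarith
    _ = _ := by ring

/-- The square modulus of the geometric sum `∑_{j < J} exp(ijθt)`. -/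
noncomputable def fejerKernel (J : ℕ) (θ t : ℝ) : ℝ :=
  ‖∑ j ∈ Finset.range J, Complex.exp (((j * θ * t : ℝ) : ℂ) * Complex.I)‖ ^ 2

theorem fejerKernel_nonneg (J : ℕ) (θ t : ℝ) : 0 ≤ fejerKernel J θ t := by
  unfold fejerKernel
  positivity

theorem fejerKernel_zero (J : ℕ) (θ : ℝ) : fejerKernel J θ 0 = (J : ℝ) ^ 2 := by
  simp [fejerKernel]

theorem fejerKernel_le (J : ℕ) (θ t : ℝ) : fejerKernel J θ t ≤ (J : ℝ) ^ 2 := by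
  refine pow_le_pow_left₀ (norm_nonneg _) ?_ 2
  refine (norm_sum_le_of_le _ (f := fun j : ℕ => Complex.exp (((j * θ * t : ℝ) : ℂ) * Complex.I))
    (n := fun _ => 1) fun j _ => (Complex.norm_exp_ofReal_mul_I _).le).trans ?_
  simp

theorem continuous_fejerKernel (J : ℕ) (θ : ℝ) : Continuous (fejerKernel J θ) := by
  unfold fejerKernel
  fun_prop

theorem fejerKernel_eq_sum (J : ℕ) (θ t : ℝ) : (fejerKernel J θ t : ℂ) =
    ∑ j ∈ Finset.range J, ∑ k ∈ Finset.range J,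
      Complex.exp ((((j : ℝ) - k) * θ : ℝ) * (t * Complex.I)) := by
  rw [fejerKernel, Complex.ofReal_pow, ← Complex.mul_conj', map_sum, Finset.sum_mul_sum]
  refine Finset.sum_congr rfl fun j _ => Finset.sum_congr rfl fun k _ => ?_
  rw [← Complex.exp_conj, ← Complex.exp_add, map_mul, Complex.conj_I, Complex.conj_ofReal]
  congr 1
  push_cast
  ring

theorem integrable_fejerKernel_mul_gaussian (J : ℕ) (θ : ℝ) {a : ℝ} (ha : 0 < a) :
    MeasureTheory.Integrable fun t : ℝ => fejerKernel J θ t * Real.exp (-a * t ^ 2) :=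
  (integrable_exp_neg_mul_sq ha).bdd_mul (c := (J : ℝ) ^ 2)
    (continuous_fejerKernel J θ).aestronglyMeasurable
    (Filter.Eventually.of_forall fun t => by
      rw [Real.norm_of_nonneg (fejerKernel_nonneg J θ t)]
      exact fejerKernel_le J θ t)

theorem integral_fejerKernel_mul_gaussian_le (J : ℕ) {θ a : ℝ} (hθ : 0 < θ) (ha : 0 < a) :
    ∫ t : ℝ, fejerKernel J θ t * Real.exp (-a * t ^ 2) ≤ J * (√(π / a) + 2 * π / θ) := by
  have hb : 0 < θ ^ 2 / (4 * a) := by positivity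
  have ha' : 0 < (a : ℂ).re := by simpa using ha
  have hint : ∀ w : ℝ, ∫ t : ℝ, Complex.exp ((w : ℂ) * (t * Complex.I)) *
      Complex.exp (-(a : ℂ) * t ^ 2) = (√(π / a) * Real.exp (-(w ^ 2) / (4 * a)) : ℝ) := by
    intro w
    have := fourierIntegral_gaussian ha' (w : ℂ)
    rw [Real.sqrt_eq_rpow, Complex.ofReal_mul, Complex.ofReal_cpow (by positivity)]
    push_cast
    rw [← this]
    refine MeasureTheory.integral_congr_ae (Filter.Eventually.of_forall fun t => ?_)
    simp only
    congr 2
    ring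
  have hint' : ∀ w : ℝ, MeasureTheory.Integrable fun t : ℝ =>
      Complex.exp ((w : ℂ) * (t * Complex.I)) * Complex.exp (-(a : ℂ) * t ^ 2) := by
    intro w
    have := integrable_cexp_neg_mul_sq ha'
    refine MeasureTheory.Integrable.bdd_mul (c := 1) ?_ (by fun_prop) ?_
    · exact this
    · refine Filter.Eventually.of_forall fun t => le_of_eq ?_
      rw [← mul_assoc, ← Complex.ofReal_mul, Complex.norm_exp_ofReal_mul_I]
  have h1 : ((∫ t : ℝ, fejerKernel J θ t * Real.exp (-a * t ^ 2) : ℝ) : ℂ) =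
      (∑ j ∈ Finset.range J, ∑ k ∈ Finset.range J,
        √(π / a) * Real.exp (-((((j : ℝ) - k) * θ) ^ 2) / (4 * a)) : ℝ) := by
    rw [← integral_complex_ofReal]
    push_cast
    simp_rw [fejerKernel_eq_sum, Finset.sum_mul]
    rw [MeasureTheory.integral_finsetSum _ fun j _ =>
      MeasureTheory.integrable_finsetSum _ fun k _ => by simpa using hint' (((j : ℝ) - k) * θ)]
    refine Finset.sum_congr rfl fun j _ => ?_
    rw [MeasureTheory.integral_finsetSum _ fun k _ => by simpa using hint' (((j : ℝ) - k) * θ)]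
    refine Finset.sum_congr rfl fun k _ => ?_
    simpa using hint (((j : ℝ) - k) * θ)
  rw [Complex.ofReal_inj] at h1
  rw [h1]
  have h2 : √(π / (θ ^ 2 / (4 * a))) = 2 * √(π * a) / θ := by
    rw [show π / (θ ^ 2 / (4 * a)) = (2 / θ) ^ 2 * (π * a) by field_simp; ring,
      Real.sqrt_mul (by positivity), Real.sqrt_sq (by positivity)]
    ring
  have h3 : √(π / a) * √(π * a) = π := by
    rw [← Real.sqrt_mul (by positivity), show π / a * (π * a) = π ^ 2 by field_simp,
      Real.sqrt_sq Real.pi_pos.le]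
  calc _ ≤ ∑ j ∈ Finset.range J, (√(π / a) + 2 * π / θ) := by
        refine Finset.sum_le_sum fun j _ => ?_
        rw [← Finset.mul_sum]
        calc _ = √(π / a) * ∑ k ∈ Finset.range J,
                Real.exp (-(θ ^ 2 / (4 * a)) * ((j : ℝ) - k) ^ 2) := by
              congr 1
              refine Finset.sum_congr rfl fun k _ => ?_
              congr 1
              ring
          _ ≤ √(π / a) * (1 + √(π / (θ ^ 2 / (4 * a)))) :=
              mul_le_mul_of_nonneg_left (sum_exp_neg_mul_sub_sq_le hb J j) (Real.sqrt_nonneg _)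
          _ = √(π / a) + 2 * (√(π / a) * √(π * a)) / θ := by
              rw [h2]
              ring
          _ = _ := by rw [h3]
    _ = _ := by rw [Finset.sum_const, Finset.card_range, nsmul_eq_mul]

/-- The vertical line integrals over the two sides of a strip agree for a function with Gaussian
decay. -/
theorem integral_vertical_line_eq {F : ℂ → ℂ} {κ K : ℝ} (hκ : 0 ≤ κ)
    (hd : ∀ z : ℂ, 0 ≤ z.re → z.re ≤ κ → DifferentiableAt ℂ F z)
    (hb : ∀ z : ℂ, 0 ≤ z.re → z.re ≤ κ → ‖F z‖ ≤ K * Real.exp (-(1 / 4) * z.im ^ 2)) :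
    ∫ y : ℝ, F (y * Complex.I) = ∫ y : ℝ, F (κ + y * Complex.I) := by
  have hgauss : MeasureTheory.Integrable fun y : ℝ => K * Real.exp (-(1 / 4) * y ^ 2) :=
    (integrable_exp_neg_mul_sq (by norm_num)).const_mul K
  have hint : ∀ x : ℝ, 0 ≤ x → x ≤ κ →
      MeasureTheory.Integrable fun y : ℝ => F (x + y * Complex.I) := by
    intro x hx hx'
    refine hgauss.mono' ?_ (Filter.Eventually.of_forall fun y => ?_)
    · refine Continuous.aestronglyMeasurable ?_
      rw [continuous_iff_continuousAt]
      intro y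
      refine ContinuousAt.comp (g := F) (f := fun y : ℝ => (x : ℂ) + y * Complex.I) ?_
        (by fun_prop)
      exact (hd _ (by simpa using hx) (by simpa using hx')).continuousAt
    · simpa using hb (x + y * Complex.I) (by simpa using hx) (by simpa using hx')
  have hrect : ∀ R : ℝ, (∫ x : ℝ in (0 : ℝ)..κ, F (x + (-R : ℝ) * Complex.I)) -
      (∫ x : ℝ in (0 : ℝ)..κ, F (x + (R : ℝ) * Complex.I)) +
      Complex.I • (∫ y : ℝ in (-R)..R, F (κ + y * Complex.I)) -
      Complex.I • (∫ y : ℝ in (-R)..R, F (y * Complex.I)) = 0 := by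
    intro R
    have := Complex.integral_boundary_rect_eq_zero_of_differentiableOn F
      (((0 : ℝ) : ℂ) + (-R : ℝ) * Complex.I) ((κ : ℂ) + (R : ℝ) * Complex.I) (by
        intro z hz
        have hz1 : z.re ∈ Set.uIcc (0 : ℝ) κ := by simpa using hz.1
        rw [Set.uIcc_of_le hκ] at hz1
        exact (hd z hz1.1 hz1.2).differentiableWithinAt)
    simpa using this
  have hhor : ∀ R : ℝ, ‖∫ x : ℝ in (0 : ℝ)..κ, F (x + (R : ℝ) * Complex.I)‖ ≤
      K * Real.exp (-(1 / 4) * R ^ 2) * κ := by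
    intro R
    have := intervalIntegral.norm_integral_le_of_norm_le_const (a := 0) (b := κ)
      (f := fun x : ℝ => F (x + (R : ℝ) * Complex.I)) (C := K * Real.exp (-(1 / 4) * R ^ 2))
      (by
        intro x hx
        rw [Set.uIoc_of_le hκ] at hx
        simpa using hb (x + R * Complex.I) (by simpa using hx.1.le) (by simpa using hx.2))
    rwa [sub_zero, abs_of_nonneg hκ] at this
  have hzero : Filter.Tendsto (fun R : ℝ => K * Real.exp (-(1 / 4) * R ^ 2) * κ) Filter.atTop
      (nhds 0) := by
    have h1 : Filter.Tendsto (fun R : ℝ => -(1 / 4) * R ^ 2) Filter.atTop Filter.atBot :=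
      (Filter.tendsto_pow_atTop two_ne_zero).const_mul_atTop_of_neg (by norm_num)
    have := ((Real.tendsto_exp_atBot.comp h1).const_mul K).mul_const κ
    simpa using this
  have hA := squeeze_zero_norm hhor hzero
  have hB : Filter.Tendsto (fun R : ℝ => ∫ x : ℝ in (0 : ℝ)..κ, F (x + (-R : ℝ) * Complex.I))
      Filter.atTop (nhds 0) :=
    squeeze_zero_norm (fun R => by simpa using hhor (-R)) hzero
  have hC := MeasureTheory.intervalIntegral_tendsto_integral (hint κ hκ le_rfl)
    Filter.tendsto_neg_atTop_atBot Filter.tendsto_id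
  have hD := MeasureTheory.intervalIntegral_tendsto_integral (hint 0 le_rfl hκ)
    Filter.tendsto_neg_atTop_atBot Filter.tendsto_id
  simp only [id, Complex.ofReal_zero, zero_add] at hC hD
  have hlim := ((hB.sub hA).add (hC.const_smul Complex.I)).sub (hD.const_smul Complex.I)
  have h0 := tendsto_nhds_unique (hlim.congr fun R => hrect R) tendsto_const_nhds
  rw [sub_zero, zero_add, sub_eq_zero] at h0
  exact (smul_right_injective ℂ Complex.I_ne_zero h0).symm

theorem one_add_abs_le_exp (t : ℝ) : 1 + |t| ≤ 4 * Real.exp (1 / 4 * t ^ 2) := by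
  have := Real.add_one_le_exp (1 / 4 * t ^ 2)
  nlinarith [sq_nonneg (|t| - 1), sq_abs t]

theorem one_add_abs_mul_exp_le (t : ℝ) :
    (1 + |t|) * Real.exp (-(1 / 2) * t ^ 2) ≤ 4 * Real.exp (-(1 / 4) * t ^ 2) := by
  calc _ ≤ 4 * Real.exp (1 / 4 * t ^ 2) * Real.exp (-(1 / 2) * t ^ 2) :=
        mul_le_mul_of_nonneg_right (one_add_abs_le_exp t) (Real.exp_pos _).le
    _ = _ := by
        rw [mul_assoc, ← Real.exp_add]
        ring_nf

/-- A Fourier coefficient against a Gaussian of a function holomorphic in a strip is controlled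
by the size of the function on the right edge. -/
theorem norm_integral_exp_mul_gaussian_mul_le {f : ℂ → ℂ} {κ A C : ℝ} (hκ : 0 ≤ κ)
    (hA : 0 ≤ A) (hd : ∀ z : ℂ, 0 ≤ z.re → z.re ≤ κ → DifferentiableAt ℂ f z)
    (hb : ∀ z : ℂ, 0 ≤ z.re → z.re ≤ κ → ‖f z‖ ≤ A * (1 + |z.im|))
    (hr : ∀ z : ℂ, z.re = κ → ‖f z‖ ≤ C) (w : ℝ) :
    ‖∫ t : ℝ, Complex.exp ((w : ℂ) * (t * Complex.I)) *
      ((Real.exp (-(1 / 2) * t ^ 2) : ℝ) * f (t * Complex.I))‖ ≤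
      C * Real.exp (κ ^ 2 / 2) * √(2 * π) * Real.exp (|w| * κ) := by
  set F : ℂ → ℂ := fun z => Complex.exp (w * z) * (Complex.exp (z ^ 2 / 2) * f z) with hF
  have hnorm : ∀ z : ℂ, 0 ≤ z.re → z.re ≤ κ → ‖F z‖ ≤
      Real.exp (|w| * κ) * (Real.exp (κ ^ 2 / 2) * Real.exp (-(1 / 2) * z.im ^ 2) * ‖f z‖) := by
    intro z hz hz'
    rw [hF, norm_mul, norm_mul, Complex.norm_exp, Complex.norm_exp, ← Real.exp_add]
    have h1 : (w * z : ℂ).re ≤ |w| * κ := by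
      rw [Complex.re_ofReal_mul]
      exact (mul_le_mul_of_nonneg_right (le_abs_self w) hz).trans
        (mul_le_mul_of_nonneg_left hz' (abs_nonneg w))
    have h2 : (z ^ 2 / 2 : ℂ).re ≤ κ ^ 2 / 2 + -(1 / 2) * z.im ^ 2 := by
      have : (z ^ 2 / 2 : ℂ).re = (z.re ^ 2 - z.im ^ 2) / 2 := by
        rw [show (2 : ℂ) = ((2 : ℝ) : ℂ) by norm_num, Complex.div_ofReal_re]
        simp [pow_two]
      rw [this]
      nlinarith
    gcongr
  have hshift := integral_vertical_line_eq (F := F) (κ := κ)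
    (K := Real.exp (|w| * κ) * Real.exp (κ ^ 2 / 2) * A * 4) hκ
    (fun z hz hz' => by
      have := hd z hz hz'
      fun_prop)
    (fun z hz hz' => by
      refine (hnorm z hz hz').trans ?_
      calc _ ≤ Real.exp (|w| * κ) * (Real.exp (κ ^ 2 / 2) * Real.exp (-(1 / 2) * z.im ^ 2) *
            (A * (1 + |z.im|))) := by
            have := hb z hz hz'
            gcongr
        _ = Real.exp (|w| * κ) * Real.exp (κ ^ 2 / 2) * A *
            ((1 + |z.im|) * Real.exp (-(1 / 2) * z.im ^ 2)) := by ring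
        _ ≤ Real.exp (|w| * κ) * Real.exp (κ ^ 2 / 2) * A *
            (4 * Real.exp (-(1 / 4) * z.im ^ 2)) :=
            mul_le_mul_of_nonneg_left (one_add_abs_mul_exp_le _) (by positivity)
        _ = _ := by ring)
  have hleft : ∫ t : ℝ, Complex.exp ((w : ℂ) * (t * Complex.I)) *
      ((Real.exp (-(1 / 2) * t ^ 2) : ℝ) * f (t * Complex.I)) = ∫ y : ℝ, F (y * Complex.I) := by
    congr 1
    funext t
    rw [hF]
    simp only
    congr 2
    rw [Complex.ofReal_exp, mul_pow, Complex.I_sq]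
    congr 1
    push_cast
    ring
  rw [hleft, hshift]
  have hg : MeasureTheory.Integrable fun y : ℝ => Real.exp (|w| * κ) * Real.exp (κ ^ 2 / 2) * C *
      Real.exp (-(1 / 2) * y ^ 2) := (integrable_exp_neg_mul_sq (by norm_num)).const_mul _
  refine (MeasureTheory.norm_integral_le_of_norm_le hg
    (Filter.Eventually.of_forall fun y => ?_)).trans (le_of_eq ?_)
  · refine (hnorm _ (by simpa using hκ) (by simp)).trans ?_
    have h1 := hr (κ + y * Complex.I) (by simp)
    calc _ ≤ Real.exp (|w| * κ) * (Real.exp (κ ^ 2 / 2) *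
          Real.exp (-(1 / 2) * ((κ : ℂ) + y * Complex.I).im ^ 2) * C) := by gcongr
      _ = _ := by
          rw [show ((κ : ℂ) + y * Complex.I).im = y by simp]
          ring
  · rw [MeasureTheory.integral_const_mul, integral_gaussian]
    rw [show π / (1 / 2) = 2 * π by ring]
    ring

theorem tendsto_integral_poisson {h : ℝ → ℝ} {B : ℝ} (hc : Continuous h) (hB : ∀ t, ‖h t‖ ≤ B) :
    Filter.Tendsto (fun δ : ℝ => ∫ t : ℝ, h t * (δ / (δ ^ 2 + t ^ 2)))
      (nhdsWithin 0 (Set.Ioi 0)) (nhds (π * h 0)) := by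
  have hlim : Filter.Tendsto (fun δ : ℝ => ∫ u : ℝ, h (δ * u) * (1 + u ^ 2)⁻¹)
      (nhdsWithin 0 (Set.Ioi 0)) (nhds (∫ u : ℝ, h 0 * (1 + u ^ 2)⁻¹)) := by
    refine MeasureTheory.tendsto_integral_filter_of_dominated_convergence
      (fun u => B * (1 + u ^ 2)⁻¹) ?_ ?_ (integrable_inv_one_add_sq.const_mul B) ?_
    · refine Filter.Eventually.of_forall fun δ => ?_
      have : Continuous fun u : ℝ => h (δ * u) := hc.comp (by fun_prop)
      exact this.aestronglyMeasurable.mul integrable_inv_one_add_sq.aestronglyMeasurable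
    · refine Filter.Eventually.of_forall fun δ => Filter.Eventually.of_forall fun u => ?_
      have h0 : (0 : ℝ) ≤ (1 + u ^ 2)⁻¹ := by positivity
      rw [norm_mul, Real.norm_of_nonneg h0]
      exact mul_le_mul_of_nonneg_right (hB _) h0
    · refine Filter.Eventually.of_forall fun u => Filter.Tendsto.mul_const _ ?_
      have : Filter.Tendsto (fun δ : ℝ => h (δ * u)) (nhds 0) (nhds (h (0 * u))) :=
        (hc.comp (continuous_id.mul continuous_const)).tendsto 0
      rw [zero_mul] at this
      exact this.mono_left nhdsWithin_le_nhds
  rw [MeasureTheory.integral_const_mul, integral_univ_inv_one_add_sq, mul_comm] at hlim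
  refine hlim.congr' ?_
  filter_upwards [self_mem_nhdsWithin] with δ hδ
  have hδ0 : (0 : ℝ) < δ := hδ
  have := MeasureTheory.Measure.integral_comp_mul_left
    (fun t : ℝ => h t * (δ / (δ ^ 2 + t ^ 2))) δ
  rw [abs_of_pos (inv_pos.mpr hδ0), smul_eq_mul, eq_inv_mul_iff_mul_eq₀ hδ0.ne'] at this
  rw [← this, ← MeasureTheory.integral_const_mul]
  congr 1
  funext u
  field_simp

theorem integrable_gaussian_mul_of_growth {f : ℂ → ℂ} {A : ℝ} (hA : 0 ≤ A)
    (hd : ∀ z : ℂ, z.re = 0 → ContinuousAt f z)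
    (hb : ∀ z : ℂ, z.re = 0 → ‖f z‖ ≤ A * (1 + |z.im|)) :
    MeasureTheory.Integrable fun t : ℝ =>
      ((Real.exp (-(1 / 2) * t ^ 2) : ℝ) : ℂ) * f (t * Complex.I) := by
  have hg : MeasureTheory.Integrable fun y : ℝ => A * (4 * Real.exp (-(1 / 4) * y ^ 2)) :=
    ((integrable_exp_neg_mul_sq (by norm_num)).const_mul 4).const_mul A
  refine hg.mono' ?_ (Filter.Eventually.of_forall fun t => ?_)
  · refine Continuous.aestronglyMeasurable ?_
    refine Continuous.mul (by fun_prop) ?_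
    rw [continuous_iff_continuousAt]
    intro t
    exact ContinuousAt.comp (g := f) (f := fun t : ℝ => (t : ℂ) * Complex.I)
      (hd _ (by simp)) (by fun_prop)
  · rw [norm_mul, Complex.norm_real, Real.norm_of_nonneg (Real.exp_pos _).le]
    have h1 := hb (t * Complex.I) (by simp)
    rw [show ((t : ℂ) * Complex.I).im = t by simp] at h1
    calc _ ≤ Real.exp (-(1 / 2) * t ^ 2) * (A * (1 + |t|)) := by gcongr
      _ = A * ((1 + |t|) * Real.exp (-(1 / 2) * t ^ 2)) := by ring
      _ ≤ _ := mul_le_mul_of_nonneg_left (one_add_abs_mul_exp_le t) hA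

theorem norm_integral_fejerKernel_mul_le {f : ℂ → ℂ} {κ A C θ : ℝ} (J : ℕ) (hκ : 0 ≤ κ)
    (hθ : 0 ≤ θ) (hC : 0 ≤ C) (hA : 0 ≤ A)
    (hd : ∀ z : ℂ, 0 ≤ z.re → z.re ≤ κ → DifferentiableAt ℂ f z)
    (hb : ∀ z : ℂ, 0 ≤ z.re → z.re ≤ κ → ‖f z‖ ≤ A * (1 + |z.im|))
    (hr : ∀ z : ℂ, z.re = κ → ‖f z‖ ≤ C) :
    ‖∫ t : ℝ, (fejerKernel J θ t : ℂ) *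
      (((Real.exp (-(1 / 2) * t ^ 2) : ℝ) : ℂ) * f (t * Complex.I))‖ ≤
      (J : ℝ) ^ 2 * (C * Real.exp (κ ^ 2 / 2) * √(2 * π) * Real.exp (J * θ * κ)) := by
  have hint : ∀ w : ℝ, MeasureTheory.Integrable fun t : ℝ =>
      Complex.exp ((w : ℂ) * (t * Complex.I)) *
        (((Real.exp (-(1 / 2) * t ^ 2) : ℝ) : ℂ) * f (t * Complex.I)) := by
    intro w
    refine (integrable_gaussian_mul_of_growth hA
      (fun z hz => (hd z hz.ge (hz.le.trans hκ)).continuousAt)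
      (fun z hz => hb z hz.ge (hz.le.trans hκ))).bdd_mul (c := 1) (by fun_prop) ?_
    refine Filter.Eventually.of_forall fun t => le_of_eq ?_
    rw [← mul_assoc, ← Complex.ofReal_mul, Complex.norm_exp_ofReal_mul_I]
  simp_rw [fejerKernel_eq_sum, Finset.sum_mul]
  rw [MeasureTheory.integral_finsetSum _ fun j _ =>
      MeasureTheory.integrable_finsetSum _ fun k _ => hint _]
  refine (norm_sum_le_of_le _ (n := fun _ => (J : ℝ) *
    (C * Real.exp (κ ^ 2 / 2) * √(2 * π) * Real.exp (J * θ * κ))) fun j hj => ?_).trans ?_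
  · rw [MeasureTheory.integral_finsetSum _ fun k _ => hint _]
    refine (norm_sum_le_of_le _ (n := fun _ =>
      C * Real.exp (κ ^ 2 / 2) * √(2 * π) * Real.exp (J * θ * κ)) fun k hk => ?_).trans ?_
    · refine (norm_integral_exp_mul_gaussian_mul_le hκ hA hd hb hr _).trans ?_
      have hj' : (j : ℝ) ≤ J := by exact_mod_cast (Finset.mem_range.mp hj).le
      have hk' : (k : ℝ) ≤ J := by exact_mod_cast (Finset.mem_range.mp hk).le
      have h1 : |(j : ℝ) - k| ≤ J := by
        rw [abs_le]
        have := Nat.cast_nonneg (α := ℝ) j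
        have := Nat.cast_nonneg (α := ℝ) k
        constructor <;> linarith
      rw [abs_mul, abs_of_nonneg hθ]
      gcongr
    · simp
  · rw [Finset.sum_const, Finset.card_range, nsmul_eq_mul]
    exact le_of_eq (by ring)

theorem integral_fejerKernel_mul_one_add_abs_le (J : ℕ) {θ : ℝ} (hθ : 0 < θ) :
    MeasureTheory.Integrable (fun t : ℝ => fejerKernel J θ t *
      ((1 + |t|) * Real.exp (-(1 / 2) * t ^ 2))) ∧
    ∫ t : ℝ, fejerKernel J θ t * ((1 + |t|) * Real.exp (-(1 / 2) * t ^ 2)) ≤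
      4 * (J * (√(4 * π) + 2 * π / θ)) := by
  have h4 := (integrable_fejerKernel_mul_gaussian J θ (a := 1 / 4) (by norm_num)).const_mul 4
  have hle : ∀ t : ℝ, fejerKernel J θ t * ((1 + |t|) * Real.exp (-(1 / 2) * t ^ 2)) ≤
      4 * (fejerKernel J θ t * Real.exp (-(1 / 4) * t ^ 2)) := fun t => by
    have := mul_le_mul_of_nonneg_left (one_add_abs_mul_exp_le t) (fejerKernel_nonneg J θ t)
    linarith
  have hint : MeasureTheory.Integrable (fun t : ℝ => fejerKernel J θ t *
      ((1 + |t|) * Real.exp (-(1 / 2) * t ^ 2))) := by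
    refine h4.mono' ?_ (Filter.Eventually.of_forall fun t => ?_)
    · exact ((continuous_fejerKernel J θ).mul (by fun_prop)).aestronglyMeasurable
    · rw [Real.norm_of_nonneg]
      · exact hle t
      · have := fejerKernel_nonneg J θ t
        positivity
  refine ⟨hint, (MeasureTheory.integral_mono hint h4 hle).trans ?_⟩
  rw [MeasureTheory.integral_const_mul]
  have := integral_fejerKernel_mul_gaussian_le J hθ (a := 1 / 4) (by norm_num)
  rw [show π / (1 / 4) = 4 * π by ring] at this
  linarith

theorem re_one_div_add_mul_I (δ t : ℝ) :
    (1 / ((δ : ℂ) + t * Complex.I)).re = δ / (δ ^ 2 + t ^ 2) := by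
  rw [one_div, Complex.inv_re, Complex.normSq_add_mul_I]
  simp

theorem multiplicity_kernel_bound {S : ℂ → ℂ} {M a c C κ θ : ℝ} (J : ℕ) (hκ : 0 < κ)
    (hκ1 : κ < 3 / 2) (hθ : 0 < θ) (ha : 0 ≤ a) (hc : 0 ≤ c) (hC : 0 ≤ C)
    (hd : ∀ s : ℂ, 1 / 2 < s.re → DifferentiableAt ℂ S s)
    (hb : ∀ δ : ℝ, 0 < δ → δ ≤ 1 → ∃ A : ℝ, 0 ≤ A ∧ ∀ s : ℂ, 1 / 2 + δ ≤ s.re → s.re ≤ 2 →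
      ‖S s‖ ≤ A * (1 + |s.im|))
    (hr : ∀ s : ℂ, 1 / 2 + κ ≤ s.re → ‖S s‖ ≤ C)
    (hM : ∀ s : ℂ, 1 / 2 < s.re → s.re ≤ 2 →
      M * (1 / (s - 1 / 2)).re ≤ a + c * (1 + |s.im|) + (S s).re) :
    M * (π * (J : ℝ) ^ 2) ≤ a * (J * (√(2 * π) + 2 * π / θ)) +
      c * (4 * (J * (√(4 * π) + 2 * π / θ))) +
      (J : ℝ) ^ 2 * (C * Real.exp (κ ^ 2 / 2) * √(2 * π) * Real.exp (J * θ * κ)) := by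
  set h : ℝ → ℝ := fun t => fejerKernel J θ t * Real.exp (-(1 / 2) * t ^ 2) with hh
  have hh0 : ∀ t, 0 ≤ h t := fun t =>
    mul_nonneg (fejerKernel_nonneg J θ t) (Real.exp_pos _).le
  have hhc : Continuous h := (continuous_fejerKernel J θ).mul (by fun_prop)
  have hhB : ∀ t, ‖h t‖ ≤ (J : ℝ) ^ 2 := fun t => by
    rw [Real.norm_of_nonneg (hh0 t)]
    refine (mul_le_of_le_one_right (fejerKernel_nonneg J θ t) ?_).trans (fejerKernel_le J θ t)
    exact Real.exp_le_one_iff.mpr (by nlinarith [sq_nonneg t])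
  have hhi : MeasureTheory.Integrable h :=
    integrable_fejerKernel_mul_gaussian J θ (by norm_num)
  have hlim := (tendsto_integral_poisson hhc hhB).const_mul M
  rw [show h 0 = (J : ℝ) ^ 2 by simp [hh, fejerKernel_zero]] at hlim
  refine le_of_tendsto hlim ?_
  have hmem : Set.Ioo (0 : ℝ) (min 1 (3 / 2 - κ)) ∈ nhdsWithin 0 (Set.Ioi 0) :=
    Ioo_mem_nhdsGT (lt_min one_pos (by linarith))
  filter_upwards [hmem] with δ hδ
  have hδ0 : 0 < δ := hδ.1
  have hδ1 : δ < 1 := hδ.2.trans_le (min_le_left _ _)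
  have hδ2 : δ < 3 / 2 - κ := hδ.2.trans_le (min_le_right _ _)
  obtain ⟨A, hA, hA'⟩ := hb δ hδ0 hδ1.le
  set f : ℂ → ℂ := fun z => S (1 / 2 + δ + z) with hf
  have hre : ∀ z : ℂ, (1 / 2 + (δ : ℂ) + z).re = 1 / 2 + δ + z.re := fun z => by
    simp
  have him : ∀ z : ℂ, (1 / 2 + (δ : ℂ) + z).im = z.im := fun z => by
    simp
  have hfd : ∀ z : ℂ, 0 ≤ z.re → z.re ≤ κ → DifferentiableAt ℂ f z := by
    intro z hz _
    have := hd (1 / 2 + δ + z) (by rw [hre]; linarith)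
    exact this.comp z (by fun_prop)
  have hfb : ∀ z : ℂ, 0 ≤ z.re → z.re ≤ κ → ‖f z‖ ≤ A * (1 + |z.im|) := by
    intro z hz hz'
    have := hA' (1 / 2 + δ + z) (by rw [hre]; linarith) (by rw [hre]; linarith)
    rwa [him] at this
  have hfr : ∀ z : ℂ, z.re = κ → ‖f z‖ ≤ C := by
    intro z hz
    exact hr _ (by rw [hre]; linarith)
  have hmain := norm_integral_fejerKernel_mul_le J hκ.le hθ.le hC hA hfd hfb hfr
  have hfi := (integrable_gaussian_mul_of_growth hA
      (fun z hz => (hfd z hz.ge (hz.le.trans hκ.le)).continuousAt)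
      (fun z hz => hfb z hz.ge (hz.le.trans hκ.le))).bdd_mul (c := (J : ℝ) ^ 2)
      (f := fun t => (fejerKernel J θ t : ℂ))
      (Complex.continuous_ofReal.comp (continuous_fejerKernel J θ)).aestronglyMeasurable
      (Filter.Eventually.of_forall fun t => by
        rw [Complex.norm_real, Real.norm_of_nonneg (fejerKernel_nonneg J θ t)]
        exact fejerKernel_le J θ t)
  have hre_eq : ∀ t : ℝ, ((fejerKernel J θ t : ℂ) *
      (((Real.exp (-(1 / 2) * t ^ 2) : ℝ) : ℂ) * f (t * Complex.I))).re =
      h t * (f (t * Complex.I)).re := fun t => by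
    rw [Complex.re_ofReal_mul, Complex.re_ofReal_mul, ← mul_assoc]
  have hfi_re : MeasureTheory.Integrable fun t : ℝ => h t * (f (t * Complex.I)).re :=
    hfi.re.congr (Filter.Eventually.of_forall hre_eq)
  have hint_re : ∫ t : ℝ, h t * (f (t * Complex.I)).re ≤
      (J : ℝ) ^ 2 * (C * Real.exp (κ ^ 2 / 2) * √(2 * π) * Real.exp (J * θ * κ)) := by
    refine le_trans ?_ ((Complex.re_le_norm _).trans hmain)
    have := integral_re hfi
    refine le_of_eq ?_
    rw [← (show _ = Complex.re _ from this)]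
    congr 1
    funext t
    exact (hre_eq t).symm
  obtain ⟨hi1, hi1'⟩ := integral_fejerKernel_mul_one_add_abs_le J hθ
  have hi0 := integral_fejerKernel_mul_gaussian_le J hθ (a := 1 / 2) (by norm_num)
  rw [show π / (1 / 2) = 2 * π by ring] at hi0
  have hpt : ∀ t : ℝ, M * (h t * (δ / (δ ^ 2 + t ^ 2))) ≤
      a * h t + c * (fejerKernel J θ t * ((1 + |t|) * Real.exp (-(1 / 2) * t ^ 2))) +
        h t * (f (t * Complex.I)).re := by
    intro t
    have h1 := hM (1 / 2 + δ + t * Complex.I) (by rw [hre]; simpa using hδ0)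
      (by rw [hre]; simp; linarith)
    rw [him, show (1 / 2 + (δ : ℂ) + t * Complex.I - 1 / 2) = δ + t * Complex.I by ring,
      re_one_div_add_mul_I, show ((t : ℂ) * Complex.I).im = t by simp] at h1
    have h2 := mul_le_mul_of_nonneg_left h1 (hh0 t)
    refine le_trans (le_of_eq (by ring)) (h2.trans (le_of_eq ?_))
    simp only [hh, hf]
    ring
  have hPi : MeasureTheory.Integrable fun t : ℝ => h t * (δ / (δ ^ 2 + t ^ 2)) := by
    refine hhi.mul_bdd (c := δ⁻¹) ?_ (Filter.Eventually.of_forall fun t => ?_)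
    · refine Continuous.aestronglyMeasurable ?_
      exact continuous_const.div (by fun_prop) fun t => by positivity
    · rw [Real.norm_of_nonneg (by positivity), div_le_iff₀ (by positivity)]
      rw [inv_mul_eq_div, le_div_iff₀ hδ0]
      nlinarith [sq_nonneg t]
  have hsum : MeasureTheory.Integrable fun t : ℝ => a * h t +
      c * (fejerKernel J θ t * ((1 + |t|) * Real.exp (-(1 / 2) * t ^ 2))) :=
    (hhi.const_mul a).add (hi1.const_mul c)
  rw [← MeasureTheory.integral_const_mul]
  refine (MeasureTheory.integral_mono (hPi.const_mul M) (hsum.add hfi_re) hpt).trans ?_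
  have h1 := MeasureTheory.integral_add hsum hfi_re
  have h2 := MeasureTheory.integral_add (hhi.const_mul a) (hi1.const_mul c)
  rw [MeasureTheory.integral_const_mul, MeasureTheory.integral_const_mul] at h2
  refine h1.le.trans ?_
  rw [h2]
  gcongr

theorem sum_log_primeFactors_le {q : ℕ} (hq : q ≠ 0) :
    ∑ p ∈ q.primeFactors, Real.log p ≤ Real.log q := by
  rw [← Real.log_prod fun p hp => by exact_mod_cast (Nat.prime_of_mem_primeFactors hp).ne_zero]
  refine Real.log_le_log (Finset.prod_pos fun p hp => by
    exact_mod_cast (Nat.prime_of_mem_primeFactors hp).pos) ?_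
  rw [← Nat.cast_prod, Nat.cast_le]
  exact Nat.le_of_dvd (Nat.pos_of_ne_zero hq) (Nat.prod_primeFactors_dvd q)

theorem exists_sum_log_div_le {η : ℝ} (hη : 0 < η) : ∃ D ≥ 0, ∀ q : ℕ, q ≠ 0 →
    ∑ p ∈ q.primeFactors, Real.log p / (√p - 1) ≤ η * Real.log q + D := by
  set P : ℕ := ⌈(1 + η⁻¹) ^ 2⌉₊ with hP
  have hterm : ∀ p : ℕ, p.Prime → 0 ≤ Real.log p / (√p - 1) := fun p hp =>
    div_nonneg (Real.log_natCast_nonneg p) (by linarith [one_lt_sqrt_prime hp])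
  refine ⟨∑ p ∈ (Finset.range P).filter Nat.Prime, Real.log p / (√p - 1),
    Finset.sum_nonneg fun p hp => hterm p (Finset.mem_filter.mp hp).2, fun q hq => ?_⟩
  have hprime : ∀ p ∈ q.primeFactors, p.Prime := fun p hp => Nat.prime_of_mem_primeFactors hp
  rw [← Finset.sum_filter_not_add_sum_filter q.primeFactors (fun p => p < P)]
  refine add_le_add ?_ ?_
  · calc _ ≤ ∑ p ∈ q.primeFactors.filter (fun p => ¬ p < P), η * Real.log p := by
          refine Finset.sum_le_sum fun p hp => ?_
          obtain ⟨hp1, hp2⟩ := Finset.mem_filter.mp hp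
          have h1 : (1 + η⁻¹) ^ 2 ≤ (p : ℝ) :=
            (Nat.le_ceil _).trans (by exact_mod_cast not_lt.mp hp2)
          have h2 : 1 + η⁻¹ ≤ √(p : ℝ) := Real.le_sqrt_of_sq_le h1
          have h3 : 0 < √(p : ℝ) - 1 := by linarith [one_lt_sqrt_prime (hprime p hp1)]
          rw [div_le_iff₀ h3]
          have h4 : 1 ≤ η * (√(p : ℝ) - 1) := by
            calc (1 : ℝ) = η * η⁻¹ := (mul_inv_cancel₀ hη.ne').symm
              _ ≤ _ := mul_le_mul_of_nonneg_left (by linarith) hη.le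
          nlinarith [Real.log_natCast_nonneg p]
      _ ≤ ∑ p ∈ q.primeFactors, η * Real.log p :=
          Finset.sum_le_sum_of_subset_of_nonneg (Finset.filter_subset _ _) fun p _ _ =>
            mul_nonneg hη.le (Real.log_natCast_nonneg p)
      _ ≤ η * Real.log q := by
          rw [← Finset.mul_sum]
          exact mul_le_mul_of_nonneg_left (sum_log_primeFactors_le hq) hη.le
  · refine Finset.sum_le_sum_of_subset_of_nonneg (fun p hp => ?_)
      fun p hp _ => hterm p (Finset.mem_filter.mp hp).2
    obtain ⟨hp1, hp2⟩ := Finset.mem_filter.mp hp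
    exact Finset.mem_filter.mpr ⟨Finset.mem_range.mpr hp2, hprime p hp1⟩

theorem inv_card_add_one_le_prod (S : Finset ℕ) : (∀ n ∈ S, 2 ≤ n) →
    ((S.card : ℝ) + 1)⁻¹ ≤ ∏ n ∈ S, (1 - (n : ℝ)⁻¹) := by
  induction S using Finset.induction_on_max with
  | empty => simp
  | insert a T hT ih =>
    intro h
    have haT : a ∉ T := fun ha => lt_irrefl a (hT a ha)
    have hcard : T.card + 2 ≤ a := by
      have h1 : T ⊆ Finset.Ico 2 a := fun n hn =>
        Finset.mem_Ico.mpr ⟨h n (Finset.mem_insert_of_mem hn), hT n hn⟩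
      have h2 := Finset.card_le_card h1
      have h3 := h a (Finset.mem_insert_self a T)
      rw [Nat.card_Ico] at h2
      omega
    have hcard' : (T.card : ℝ) + 2 ≤ a := by exact_mod_cast hcard
    have hc0 : (0 : ℝ) ≤ T.card := Nat.cast_nonneg _
    rw [Finset.prod_insert haT, Finset.card_insert_of_notMem haT]
    push_cast
    have h1 := ih fun n hn => h n (Finset.mem_insert_of_mem hn)
    have h2 : (a : ℝ)⁻¹ ≤ ((T.card : ℝ) + 2)⁻¹ := inv_anti₀ (by positivity) hcard'
    have h3 : ((T.card : ℝ) + 2)⁻¹ ≤ 1 := inv_le_one_of_one_le₀ (by linarith)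
    calc ((T.card : ℝ) + 1 + 1)⁻¹ = (1 - ((T.card : ℝ) + 2)⁻¹) * ((T.card : ℝ) + 1)⁻¹ := by
          field_simp
          ring
      _ ≤ _ := mul_le_mul (by linarith) h1 (by positivity) (by linarith)

theorem le_totient_mul_log {q : ℕ} (hq : q ≠ 0) :
    (q : ℝ) ≤ q.totient * (Real.log q / Real.log 2 + 1) := by
  have hω : (q.primeFactors.card : ℝ) ≤ Real.log q / Real.log 2 := by
    rw [le_div_iff₀ (Real.log_pos one_lt_two), ← Real.log_pow]
    refine Real.log_le_log (by positivity) ?_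
    have h1 : 2 ^ q.primeFactors.card ≤ ∏ p ∈ q.primeFactors, p :=
      Finset.pow_card_le_prod _ _ _ fun p hp => (Nat.prime_of_mem_primeFactors hp).two_le
    exact_mod_cast h1.trans (Nat.le_of_dvd (Nat.pos_of_ne_zero hq) (Nat.prod_primeFactors_dvd q))
  have htot : (q.totient : ℝ) = q * ∏ p ∈ q.primeFactors, (1 - (p : ℝ)⁻¹) := by
    have := congrArg (Rat.cast : ℚ → ℝ) (Nat.totient_eq_mul_prod_factors q)
    push_cast at this
    exact this
  have hprod := inv_card_add_one_le_prod q.primeFactors fun p hp =>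
    (Nat.prime_of_mem_primeFactors hp).two_le
  have hc0 : (0 : ℝ) ≤ q.primeFactors.card := Nat.cast_nonneg _
  calc (q : ℝ) = q * ((q.primeFactors.card : ℝ) + 1)⁻¹ * (q.primeFactors.card + 1) := by
        field_simp
    _ ≤ q * (∏ p ∈ q.primeFactors, (1 - (p : ℝ)⁻¹)) * (Real.log q / Real.log 2 + 1) := by
        gcongr
        refine mul_nonneg (Nat.cast_nonneg _) (Finset.prod_nonneg fun p hp => ?_)
        have : (1 : ℝ) ≤ p := by
          exact_mod_cast (Nat.prime_of_mem_primeFactors hp).one_lt.le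
        linarith [inv_le_one_of_one_le₀ this]
    _ = _ := by rw [htot]

theorem eventually_mul_rpow_le_totient (K : ℝ) {η : ℝ} (hη : 0 < η) :
    ∀ᶠ q : ℕ in Filter.atTop, K * (q : ℝ) ^ (1 - η) ≤ q.totient := by
  have h1 : (fun x : ℝ => K * (Real.log x / Real.log 2 + 1)) =o[Filter.atTop] fun x => x ^ η := by
    refine Asymptotics.IsLittleO.const_mul_left (Asymptotics.IsLittleO.add ?_ ?_) K
    · simp_rw [div_eq_inv_mul]
      exact (isLittleO_log_rpow_atTop hη).const_mul_left _
    · exact (Asymptotics.isLittleO_const_left_of_ne one_ne_zero).mpr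
        (tendsto_norm_atTop_atTop.comp (tendsto_rpow_atTop hη))
  have h2 := (h1.bound one_pos)
  filter_upwards [tendsto_natCast_atTop_atTop.eventually h2, Filter.eventually_gt_atTop 0]
    with q hq hq0
  have hq0' : (0 : ℝ) < q := by exact_mod_cast hq0
  have hq1 : (1 : ℝ) ≤ q := by exact_mod_cast hq0
  have hlog : 0 < Real.log q / Real.log 2 + 1 := by
    have := Real.log_nonneg hq1
    have := Real.log_pos one_lt_two
    positivity
  rw [one_mul, Real.norm_of_nonneg (by positivity : (0 : ℝ) ≤ (q : ℝ) ^ η)] at hq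
  have h3 := (le_abs_self _).trans hq
  refine le_of_mul_le_mul_right ?_ hlog
  refine le_trans ?_ (le_totient_mul_log hq0.ne')
  calc _ = (q : ℝ) ^ (1 - η) * (K * (Real.log q / Real.log 2 + 1)) := by ring
    _ ≤ (q : ℝ) ^ (1 - η) * (q : ℝ) ^ η := mul_le_mul_of_nonneg_left h3 (by positivity)
    _ = q := by rw [← Real.rpow_add hq0', sub_add_cancel, Real.rpow_one]

theorem analyticOrderAt_riemannZeta_half_ne_top : analyticOrderAt riemannZeta (1 / 2) ≠ ⊤ := by
  intro h
  rw [analyticOrderAt_eq_top] at h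
  have hU : IsPreconnected ({1}ᶜ : Set ℂ) :=
    (isConnected_compl_singleton_of_one_lt_rank (by simp) 1).isPreconnected
  have hd : DifferentiableOn ℂ riemannZeta {1}ᶜ := fun s hs =>
    (differentiableAt_riemannZeta hs).differentiableWithinAt
  have hz := (hd.analyticOnNhd isOpen_compl_singleton).eqOn_zero_of_preconnected_of_eventuallyEq_zero
    hU (z₀ := 1 / 2) (by norm_num) h
  have h2 : riemannZeta 2 = 0 := hz (by norm_num)
  exact riemannZeta_ne_zero_of_one_le_re (by norm_num) h2

theorem exists_ordAt_principal_le : ∃ m : ℕ, ∀ (q : ℕ) [NeZero q],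
    ordAt (Lfunc q (1 : DirichletCharacter ℂ q)) (1 / 2) ≤ m := by
  obtain ⟨m, hm⟩ := ENat.ne_top_iff_exists.mp analyticOrderAt_riemannZeta_half_ne_top
  refine ⟨m, fun q _ => ?_⟩
  have hU : ({1}ᶜ : Set ℂ) ∈ nhds (1 / 2 : ℂ) := isOpen_compl_singleton.mem_nhds (by norm_num)
  have hζ : AnalyticAt ℂ riemannZeta (1 / 2) :=
    DifferentiableOn.analyticAt (s := {1}ᶜ)
      (fun s hs => (differentiableAt_riemannZeta hs).differentiableWithinAt) hU
  have hL : AnalyticAt ℂ (DirichletCharacter.LFunction (1 : DirichletCharacter ℂ q)) (1 / 2) :=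
    DifferentiableOn.analyticAt (s := {1}ᶜ)
      (fun s hs => (DirichletCharacter.differentiableAt_LFunction 1 s
        (.inl hs)).differentiableWithinAt) hU
  have hprime : ∀ p ∈ q.primeFactors, p.Prime := fun p hp => Nat.prime_of_mem_primeFactors hp
  set E : ℂ → ℂ := fun s => ∏ p ∈ q.primeFactors,
    (1 - (1 : DirichletCharacter ℂ 1) p * (p : ℂ) ^ (-s)) with hE
  have hEd : Differentiable ℂ E :=
    Differentiable.fun_finsetProd fun p hp => differentiable_eulerFactor 1 (hprime p hp)
  have heq : DirichletCharacter.LFunction (1 : DirichletCharacter ℂ q) =ᶠ[nhds (1 / 2)]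
      E * riemannZeta := by
    filter_upwards [hU] with s hs
    have h1 : ∀ p : ℕ, (1 : DirichletCharacter ℂ 1) (p : ZMod 1) = 1 := fun p =>
      MulChar.one_apply (by rw [Subsingleton.elim (p : ZMod 1) 1]; exact isUnit_one)
    simp only [Pi.mul_apply, hE, h1, one_mul]
    exact DirichletCharacter.LFunctionTrivChar_eq_mul_riemannZeta hs
  have h := ordAt_le_analyticOrderAt hL
  rw [analyticOrderAt_congr heq, analyticOrderAt_mul (hEd.analyticAt _) hζ,
    (hEd.analyticAt _).analyticOrderAt_eq_zero.mpr (Finset.prod_ne_zero_iff.mpr fun p hp =>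
      eulerFactor_ne_zero 1 (hprime p hp) (by norm_num)), zero_add, ← hm] at h
  rw [Lfunc_eq_LFunction]
  exact_mod_cast h

theorem differentiableAt_logDeriv_of_differentiable {f : ℂ → ℂ} (hf : Differentiable ℂ f) {s : ℂ}
    (hs : f s ≠ 0) : DifferentiableAt ℂ (logDeriv f) s :=
  ((hf.analyticAt s).deriv.differentiableAt).div (hf s) hs

theorem card_dirichletCharacter (q : ℕ) [NeZero q] :
    (Finset.univ : Finset (DirichletCharacter ℂ q)).card = q.totient := by
  rw [Finset.card_univ, ← Nat.card_eq_fintype_card]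
  exact DirichletCharacter.card_eq_totient_of_hasEnoughRootsOfUnity ℂ q

theorem exists_sum_ordAt_kernel_bound {η : ℝ} (hη : 0 < η) (hη1 : η < 1) {θ : ℝ} (hθ : 0 < θ) :
    ∃ C D K : ℝ, 0 ≤ C ∧ 0 ≤ D ∧ 0 ≤ K ∧ ∀ (q : ℕ) [NeZero q],
      (∀ χ : DirichletCharacter ℂ q, χ ≠ 1 → GRHchi χ) → ∀ J : ℕ,
      (∑ χ ∈ (Finset.univ : Finset (DirichletCharacter ℂ q)).erase 1,
        (ordAt (Lfunc q χ) (1 / 2) : ℝ)) * (π * (J : ℝ) ^ 2) ≤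
      q.totient * ((1 / 2 + η) * Real.log q + D) * (J * (√(2 * π) + 2 * π / θ)) +
        q.totient * C * (4 * (J * (√(4 * π) + 2 * π / θ))) +
        (J : ℝ) ^ 2 * (K * Real.exp (J * θ * (1 / 2 + η))) := by
  obtain ⟨C, hC, hCb⟩ := exists_ordAt_mul_re_inv_le
  obtain ⟨D, hD, hDb⟩ := exists_sum_log_div_le hη
  obtain ⟨K, hK, hKb⟩ := exists_norm_sum_logDeriv_le hη
  refine ⟨C, D, K * Real.exp ((1 / 2 + η) ^ 2 / 2) * √(2 * π), hC.le, hD, by positivity,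
    fun q _ hG J => ?_⟩
  set T := (Finset.univ : Finset (DirichletCharacter ℂ q)).erase 1 with hT
  have hT1 : ∀ χ ∈ T, χ ≠ 1 := fun χ hχ => Finset.ne_of_mem_erase hχ
  have hcard : (T.card : ℝ) ≤ q.totient := by
    rw [← card_dirichletCharacter q]
    exact_mod_cast Finset.card_le_card (Finset.erase_subset _ _)
  have hlog : 0 ≤ (1 / 2 + η) * Real.log q + D := by
    have := Real.log_natCast_nonneg q
    positivity
  refine multiplicity_kernel_bound
    (S := fun s => ∑ χ ∈ T, logDeriv (DirichletCharacter.LFunction χ) s)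
    J (by linarith) (by linarith) hθ (by positivity) (by positivity) hK.le ?_ ?_ ?_ ?_
  · intro s hs
    exact DifferentiableAt.fun_sum fun χ hχ => differentiableAt_logDeriv_of_differentiable
      (DirichletCharacter.differentiable_LFunction (hT1 χ hχ))
      (LFunction_ne_zero_of_GRHchi (hT1 χ hχ) (hG χ (hT1 χ hχ)) hs)
  · intro δ hδ hδ1
    have hex : ∀ χ : DirichletCharacter ℂ q, ∃ A : ℝ, 0 ≤ A ∧ (χ ∈ T → ∀ s : ℂ,
        1 / 2 + δ ≤ s.re → s.re ≤ 2 →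
          ‖logDeriv (DirichletCharacter.LFunction χ) s‖ ≤ A * (1 + |s.im|)) := by
      intro χ
      by_cases hχ : χ ∈ T
      · obtain ⟨A, hA, hAb⟩ :=
          exists_norm_logDeriv_LFunction_le (hT1 χ hχ) (hG χ (hT1 χ hχ)) hδ hδ1
        exact ⟨A, hA.le, fun _ => hAb⟩
      · exact ⟨0, le_rfl, fun h => absurd h hχ⟩
    choose A hA0 hA using hex
    refine ⟨∑ χ ∈ T, A χ, Finset.sum_nonneg fun χ _ => hA0 χ, fun s hs hs2 => ?_⟩
    rw [Finset.sum_mul]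
    exact norm_sum_le_of_le _ fun χ hχ => hA χ hχ s hs hs2
  · intro s hs
    exact hKb q s (by linarith)
  · intro s hs hs2
    rw [Finset.sum_mul, Complex.re_sum]
    have hB := hDb q (NeZero.ne q)
    calc _ ≤ ∑ χ ∈ T, (((1 / 2 + η) * Real.log q + D) + C * (1 + |s.im|) +
          (logDeriv (DirichletCharacter.LFunction χ) s).re) := by
          refine Finset.sum_le_sum fun χ hχ => ?_
          have := hCb q χ (hT1 χ hχ) (hG χ (hT1 χ hχ)) s hs hs2
          linarith
      _ = T.card * (((1 / 2 + η) * Real.log q + D) + C * (1 + |s.im|)) +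
          ∑ χ ∈ T, (logDeriv (DirichletCharacter.LFunction χ) s).re := by
          rw [Finset.sum_add_distrib, Finset.sum_const, nsmul_eq_mul]
      _ ≤ q.totient * (((1 / 2 + η) * Real.log q + D) + C * (1 + |s.im|)) +
          ∑ χ ∈ T, (logDeriv (DirichletCharacter.LFunction χ) s).re := by
          gcongr
      _ = _ := by ring

theorem tendsto_affine_div_floor (a E : ℝ) {c : ℝ} (hc : 0 < c) :
    Tendsto (fun x : ℝ => (a * x + E) / (⌊c * x⌋₊ : ℝ)) atTop (nhds (a / c)) := by
  have h1 : Tendsto (fun x : ℝ => a + E / x) atTop (nhds a) := by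
    simpa using (tendsto_const_nhds (x := a)).add
      ((tendsto_const_nhds (x := E)).div_atTop (tendsto_id (α := ℝ) (x := atTop)))
  refine (h1.div (tendsto_nat_floor_mul_div_atTop hc.le) hc.ne').congr' ?_
  filter_upwards [eventually_gt_atTop 0] with x hx
  simp only [Pi.div_apply]
  rw [show a + E / x = (a * x + E) / x by field_simp, div_div_div_cancel_right₀ hx.ne']

theorem exists_main_coefficient_lt {ε : ℝ} (hε : 0 < ε) : ∃ η : ℝ, 0 < η ∧ η < 1 / 2 ∧
    (1 / 2 + η) * (√(2 * π) + 2 * π / η) / π / (2 * (1 - η) / ((1 + 2 * η) * η)) < 1 / 2 + ε := by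
  set g : ℝ → ℝ := fun η =>
    (1 / 2 + η) * (η * √(2 * π) + 2 * π) * (1 + 2 * η) / (π * (2 * (1 - η))) with hg
  have hcont : ContinuousAt g 0 := by
    refine ContinuousAt.div (by fun_prop) (by fun_prop) ?_
    simp [Real.pi_ne_zero]
  have h0 : g 0 < 1 / 2 + ε := by
    have : g 0 = 1 / 2 := by
      simp only [hg]
      field_simp
      norm_num
    linarith
  have h1 : ∀ᶠ η in nhdsWithin (0 : ℝ) (Set.Ioi 0), g η < 1 / 2 + ε :=
    (hcont.eventually (gt_mem_nhds h0)).filter_mono nhdsWithin_le_nhds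
  have h2 : ∀ᶠ η in nhdsWithin (0 : ℝ) (Set.Ioi 0), η < 1 / 2 :=
    (gt_mem_nhds (by norm_num)).filter_mono nhdsWithin_le_nhds
  obtain ⟨η, hη1, hη2, hη3⟩ := (h1.and (h2.and self_mem_nhdsWithin)).exists
  have hη0 : 0 < η := hη3
  refine ⟨η, hη0, hη2, lt_of_eq_of_lt ?_ hη1⟩
  have h3 : 1 - η ≠ 0 := by linarith
  have h4 : 1 + 2 * η ≠ 0 := by positivity
  simp only [hg]
  field_simp

theorem eventually_sum_nonprincipal_ordAt_le {ε : ℝ} (hε : 0 < ε) :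
    ∀ᶠ q : ℕ in atTop, ∀ [NeZero q], (∀ χ : DirichletCharacter ℂ q, χ ≠ 1 → GRHchi χ) →
      ∑ χ ∈ (Finset.univ : Finset (DirichletCharacter ℂ q)).erase 1,
        (ordAt (Lfunc q χ) (1 / 2) : ℝ) ≤ (1 / 2 + ε) * q.totient := by
  obtain ⟨η, hη, hη2, hcoef⟩ := exists_main_coefficient_lt (half_pos hε)
  obtain ⟨C, D, K, hC, hD, hK, hb⟩ := exists_sum_ordAt_kernel_bound hη (by linarith) hη
  set A := √(2 * π) + 2 * π / η with hA
  set B := √(4 * π) + 2 * π / η with hB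
  set c := 2 * (1 - η) / ((1 + 2 * η) * η) with hc
  have hη1 : 0 < 1 - η := by linarith
  have hc0 : 0 < c := by positivity
  have hlog : Tendsto (fun q : ℕ => Real.log q) atTop atTop :=
    Real.tendsto_log_atTop.comp tendsto_natCast_atTop_atTop
  have hmain := hlog.eventually ((tendsto_affine_div_floor ((1 / 2 + η) * A / π)
    ((D * A + 4 * C * B) / π) hc0).eventually (gt_mem_nhds hcoef))
  have hJ := hlog.eventually (eventually_ge_atTop c⁻¹)
  filter_upwards [hmain, hJ, eventually_mul_rpow_le_totient (2 * K / (π * ε)) hη,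
    eventually_gt_atTop 0] with q hq1 hq2 hq3 hq0
  intro _ hG
  have hq0' : (0 : ℝ) < q := by exact_mod_cast hq0
  set J := ⌊c * Real.log q⌋₊ with hJdef
  have hJ1 : 1 ≤ J := Nat.le_floor (by
    rw [Nat.cast_one, ← mul_inv_cancel₀ hc0.ne']
    exact mul_le_mul_of_nonneg_left hq2 hc0.le)
  have hJ0 : (0 : ℝ) < J := by exact_mod_cast hJ1
  have hJle : (J : ℝ) ≤ c * Real.log q :=
    Nat.floor_le (mul_nonneg hc0.le (Real.log_natCast_nonneg q))
  have hexp : Real.exp (J * η * (1 / 2 + η)) ≤ (q : ℝ) ^ (1 - η) := by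
    rw [Real.rpow_def_of_pos hq0']
    refine Real.exp_le_exp.mpr ?_
    calc (J : ℝ) * η * (1 / 2 + η) = J * (η * (1 / 2 + η)) := by ring
      _ ≤ c * Real.log q * (η * (1 / 2 + η)) := by gcongr
      _ = Real.log q * (1 - η) := by
          rw [hc]
          field_simp
  have hφ : (0 : ℝ) ≤ q.totient := Nat.cast_nonneg _
  have hK' : K * (q : ℝ) ^ (1 - η) ≤ π * (ε / 2) * q.totient := by
    have := mul_le_mul_of_nonneg_left hq3 (by positivity : 0 ≤ π * (ε / 2))
    refine le_of_eq_of_le ?_ this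
    field_simp
  have hmul : ((1 / 2 + η) * Real.log q + D) * A + 4 * C * B ≤ (1 / 2 + ε / 2) * (π * J) := by
    have h := (div_lt_iff₀ hJ0).mp hq1
    have h' := mul_le_mul_of_nonneg_left h.le Real.pi_pos.le
    refine le_trans (le_of_eq ?_) (h'.trans (le_of_eq (by ring)))
    field_simp
    ring
  refine le_of_mul_le_mul_right ((hb q hG J).trans ?_) (by positivity : 0 < π * (J : ℝ) ^ 2)
  calc _ = q.totient * J * (((1 / 2 + η) * Real.log q + D) * A + 4 * C * B) +
        (J : ℝ) ^ 2 * (K * Real.exp (J * η * (1 / 2 + η))) := by ring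
    _ ≤ q.totient * J * ((1 / 2 + ε / 2) * (π * J)) +
        (J : ℝ) ^ 2 * (π * (ε / 2) * q.totient) := by
        refine add_le_add (mul_le_mul_of_nonneg_left hmul (by positivity))
          (mul_le_mul_of_nonneg_left ?_ (by positivity))
        exact (mul_le_mul_of_nonneg_left hexp hK).trans hK'
    _ = _ := by ring

theorem multiplicity_bound (ε : ℝ) (hε : 0 < ε) :
    ∃ Q₀ : ℕ, ∀ q : ℕ, Q₀ ≤ q →
      (∀ χ : DirichletCharacter ℂ q, χ ≠ 1 → GRHchi χ) →
      (∑ᶠ χ : DirichletCharacter ℂ q, (ordAt (Lfunc q χ) (1 / 2 : ℂ) : ℝ)) ≤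
        (1 / 2 + ε) * Nat.totient q := by
  obtain ⟨m, hm⟩ := exists_ordAt_principal_le
  refine Filter.eventually_atTop.mp ?_
  filter_upwards [eventually_sum_nonprincipal_ordAt_le (half_pos hε),
    eventually_mul_rpow_le_totient (2 * m / ε) (η := 1 / 2) (by norm_num),
    eventually_gt_atTop 0] with q hq1 hq2 hq0 hG
  have : NeZero q := ⟨hq0.ne'⟩
  have hq1' : (1 : ℝ) ≤ q := by exact_mod_cast hq0
  have hprin : (ordAt (Lfunc q (1 : DirichletCharacter ℂ q)) (1 / 2) : ℝ) ≤
      ε / 2 * q.totient := by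
    have h1 : (1 : ℝ) ≤ (q : ℝ) ^ (1 - 1 / 2 : ℝ) := Real.one_le_rpow hq1' (by norm_num)
    calc _ ≤ (m : ℝ) := by exact_mod_cast hm q
      _ = ε / 2 * (2 * m / ε * 1) := by field_simp
      _ ≤ ε / 2 * (2 * m / ε * (q : ℝ) ^ (1 - 1 / 2 : ℝ)) := by gcongr
      _ ≤ _ := by gcongr
  rw [finsum_eq_sum_of_fintype, ← Finset.add_sum_erase _ _ (Finset.mem_univ 1)]
  linarith [hq1 hG]
end

section
/- Let w : ℕ → ℝ_{>0} be any function tending to zero as q → ∞. Then there exists a constant C > 0 (depending on w) such that for each integer q ≥ 3 there exists a set F_q of Dirichlet characters modulo q with the following properties: (i) F_q is closed under complex conjugation (χ ∈ F_q if and only if χ̄ ∈ F_q); (ii) #F_q ≥ φ(q)·(1 − C·w(q)²); and (iii) |log q_χ − log q| ≤ C·w(q)^{−1}·log log q for every χ ∈ F_q, where q_χ denotes the conductor of χ. -/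
open Filter Real Complex
open scoped Classical

/-- The complex conjugate of a Dirichlet character. -/
noncomputable def conjChar {q : ℕ} (χ : DirichletCharacter ℂ q) : DirichletCharacter ℂ q :=
  χ.ringHomComp (starRingEnd ℂ)

open ArithmeticFunction Chebyshev in
/-- The upper bound in the first theorem of Mertens. -/
lemma sum_vonMangoldt_div_le {N : ℕ} (hN : 0 < N) :
    ∑ n ∈ Finset.Ioc 0 N, vonMangoldt n / n ≤ Real.log N + (Real.log 4 + 4) := by
  have hN' : (0 : ℝ) < N := by exact_mod_cast hN
  have hlog : ∑ n ∈ Finset.Ioc 0 N, vonMangoldt n * ((N / n : ℕ) : ℝ) ≤ N * Real.log N := by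
    rw [← sum_Ioc_mul_zeta_eq_sum, vonMangoldt_mul_zeta]
    calc ∑ n ∈ Finset.Ioc 0 N, ArithmeticFunction.log n ≤ ∑ n ∈ Finset.Ioc 0 N, Real.log N := by
          refine Finset.sum_le_sum fun n hn ↦ ?_
          rw [Finset.mem_Ioc] at hn
          rw [log_apply]
          exact Real.log_le_log (by exact_mod_cast hn.1) (by exact_mod_cast hn.2)
      _ = N * Real.log N := by simp
  have hpsi : ∑ n ∈ Finset.Ioc 0 N, vonMangoldt n ≤ (Real.log 4 + 4) * N := by
    have h := psi_le_const_mul_self hN'.le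
    rwa [psi, Nat.floor_natCast] at h
  have hmul : N * ∑ n ∈ Finset.Ioc 0 N, vonMangoldt n / n ≤
      N * (Real.log N + (Real.log 4 + 4)) := by
    calc N * ∑ n ∈ Finset.Ioc 0 N, vonMangoldt n / n
        ≤ ∑ n ∈ Finset.Ioc 0 N, (vonMangoldt n * ((N / n : ℕ) : ℝ) + vonMangoldt n) := by
          rw [Finset.mul_sum]
          refine Finset.sum_le_sum fun n _ ↦ ?_
          have hfloor : (N : ℝ) / n ≤ ((N / n : ℕ) : ℝ) + 1 := by
            rw [← Nat.floor_div_eq_div (K := ℝ)]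
            exact (Nat.lt_floor_add_one _).le
          have hΛ := mul_le_mul_of_nonneg_left hfloor (vonMangoldt_nonneg (n := n))
          calc (N : ℝ) * (vonMangoldt n / n) = vonMangoldt n * (N / n) := by ring
            _ ≤ _ := by linarith
      _ ≤ _ := by rw [Finset.sum_add_distrib]; linarith
  exact le_of_mul_le_mul_left hmul hN'

open ArithmeticFunction in
/-- The divisors of `q` up to `log q` contribute at most `log log q + O(1)`
to `∑ a ∣ q, Λ a / a`. -/
lemma sum_small_divisors_vonMangoldt_div_le {q : ℕ} (hq : 1 ≤ Real.log q) :
    ∑ a ∈ q.divisors with ((a : ℕ) : ℝ) ≤ Real.log q, vonMangoldt a / a ≤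
      Real.log (Real.log q) + (Real.log 4 + 4) := by
  have hfl : 0 < ⌊Real.log q⌋₊ := Nat.floor_pos.mpr hq
  calc ∑ a ∈ q.divisors with ((a : ℕ) : ℝ) ≤ Real.log q, vonMangoldt a / a
      ≤ ∑ a ∈ Finset.Ioc 0 ⌊Real.log q⌋₊, vonMangoldt a / a := by
        refine Finset.sum_le_sum_of_subset_of_nonneg (fun a ha ↦ ?_)
          fun a _ _ ↦ div_nonneg vonMangoldt_nonneg a.cast_nonneg
        rw [Finset.mem_filter] at ha
        exact Finset.mem_Ioc.mpr ⟨Nat.pos_of_mem_divisors ha.1, Nat.le_floor ha.2⟩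
    _ ≤ Real.log ⌊Real.log q⌋₊ + (Real.log 4 + 4) := sum_vonMangoldt_div_le hfl
    _ ≤ _ := by
        gcongr
        exact Nat.floor_le (by linarith)

open ArithmeticFunction in
lemma sum_large_divisors_vonMangoldt_le (q : ℕ) :
    ∑ a ∈ q.divisors with ¬ ((a : ℕ) : ℝ) ≤ Real.log q, vonMangoldt a ≤ Real.log q :=
  (Finset.sum_le_sum_of_subset_of_nonneg (Finset.filter_subset _ _)
    fun _ _ _ ↦ vonMangoldt_nonneg).trans_eq vonMangoldt_sum

open ArithmeticFunction in
lemma sum_divisors_vonMangoldt_div_le {q : ℕ} (hq : 1 ≤ Real.log q) :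
    ∑ a ∈ q.divisors, vonMangoldt a / a ≤ Real.log (Real.log q) + (Real.log 4 + 5) := by
  have hy : 0 < Real.log q := by linarith
  have hlarge : ∑ a ∈ q.divisors with ¬ ((a : ℕ) : ℝ) ≤ Real.log q, vonMangoldt a / a ≤ 1 := by
    calc ∑ a ∈ q.divisors with ¬ ((a : ℕ) : ℝ) ≤ Real.log q, vonMangoldt a / a
        ≤ ∑ a ∈ q.divisors with ¬ ((a : ℕ) : ℝ) ≤ Real.log q, vonMangoldt a / Real.log q := by
          refine Finset.sum_le_sum fun a ha ↦ ?_
          rw [Finset.mem_filter, not_le] at ha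
          exact div_le_div_of_nonneg_left vonMangoldt_nonneg hy ha.2.le
      _ ≤ 1 := by
          rw [← Finset.sum_div, div_le_one hy]
          exact sum_large_divisors_vonMangoldt_le q
  rw [← Finset.sum_filter_add_sum_filter_not _ (fun a : ℕ ↦ (a : ℝ) ≤ Real.log q)]
  linarith [sum_small_divisors_vonMangoldt_div_le hq]

open ArithmeticFunction in
lemma sum_divisors_vonMangoldt_mul_log_div_le {q : ℕ} (hq : 1 ≤ Real.log q) :
    ∑ a ∈ q.divisors, vonMangoldt a * Real.log a / a ≤
      Real.log (Real.log q) * (Real.log (Real.log q) + (Real.log 4 + 4)) +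
        (Real.log (Real.log q) + 1) := by
  have hy : 0 < Real.log q := by linarith
  have hL : 0 ≤ Real.log (Real.log q) := Real.log_nonneg hq
  rw [← Finset.sum_filter_add_sum_filter_not _ (fun a : ℕ ↦ (a : ℝ) ≤ Real.log q)]
  refine add_le_add ?_ ?_
  · refine le_trans ?_ (mul_le_mul_of_nonneg_left (sum_small_divisors_vonMangoldt_div_le hq) hL)
    rw [Finset.mul_sum]
    refine Finset.sum_le_sum fun a ha ↦ ?_
    rw [Finset.mem_filter] at ha
    have ha0 : (0 : ℝ) < a := by exact_mod_cast Nat.pos_of_mem_divisors ha.1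
    calc vonMangoldt a * Real.log a / a = Real.log a * (vonMangoldt a / a) := by ring
      _ ≤ _ := mul_le_mul_of_nonneg_right (Real.log_le_log ha0 ha.2)
          (div_nonneg vonMangoldt_nonneg ha0.le)
  · calc ∑ a ∈ q.divisors with ¬ ((a : ℕ) : ℝ) ≤ Real.log q, vonMangoldt a * Real.log a / a
        ≤ ∑ a ∈ q.divisors with ¬ ((a : ℕ) : ℝ) ≤ Real.log q,
            vonMangoldt a * ((Real.log (Real.log q) + 1) / Real.log q) := by
          refine Finset.sum_le_sum fun a ha ↦ ?_
          rw [Finset.mem_filter, not_le] at ha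
          have ha0 : (0 : ℝ) < a := hy.trans ha.2
          rw [mul_div_assoc]
          refine mul_le_mul_of_nonneg_left ?_ vonMangoldt_nonneg
          have hlog : Real.log a ≤ Real.log (Real.log q) + a / Real.log q := by
            have h := Real.log_le_sub_one_of_pos (div_pos ha0 hy)
            rw [Real.log_div ha0.ne' hy.ne'] at h
            linarith
          rw [div_le_div_iff₀ ha0 hy]
          calc Real.log a * Real.log q
              ≤ (Real.log (Real.log q) + a / Real.log q) * Real.log q := by gcongr
            _ = Real.log (Real.log q) * Real.log q + a := by field_simp
            _ ≤ Real.log (Real.log q) * a + a := by gcongr; exact ha.2.le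
            _ = _ := by ring
      _ ≤ Real.log q * ((Real.log (Real.log q) + 1) / Real.log q) := by
          rw [← Finset.sum_mul]
          exact mul_le_mul_of_nonneg_right (sum_large_divisors_vonMangoldt_le q) (by positivity)
      _ = _ := by field_simp

open ArithmeticFunction in
/-- The Selberg identity `log² = Λ log * 1 + Λ * Λ * 1`, with sums over divisors of a multiple. -/
lemma log_sq_eq_sum_divisors {D q : ℕ} (hD : D ∣ q) (hq : q ≠ 0) :
    Real.log D ^ 2 =
      ∑ a ∈ q.divisors, (if a ∣ D then vonMangoldt a * Real.log a else 0) +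
      ∑ a ∈ q.divisors, ∑ b ∈ q.divisors,
        (if a * b ∣ D then vonMangoldt a * vonMangoldt b else 0) := by
  have hfilter : ∀ E, E ∣ q → q.divisors.filter (· ∣ E) = E.divisors := by
    intro E hE
    ext a
    simp only [Finset.mem_filter, Nat.mem_divisors]
    exact ⟨fun h ↦ ⟨h.2, ne_zero_of_dvd_ne_zero hq hE⟩, fun h ↦ ⟨⟨h.1.trans hE, hq⟩, h.1⟩⟩
  have hinner : ∀ a ∈ q.divisors, (∑ b ∈ q.divisors,
      (if a * b ∣ D then vonMangoldt a * vonMangoldt b else 0)) =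
      if a ∣ D then vonMangoldt a * (Real.log D - Real.log a) else 0 := by
    intro a _
    split_ifs with haD
    · obtain ⟨E, rfl⟩ := haD
      have h0 : a * E ≠ 0 := ne_zero_of_dvd_ne_zero hq hD
      have ha0 : a ≠ 0 := left_ne_zero_of_mul h0
      have hE0 : E ≠ 0 := right_ne_zero_of_mul h0
      simp only [Nat.mul_dvd_mul_iff_left (Nat.pos_of_ne_zero ha0)]
      rw [← Finset.sum_filter, hfilter E ((Dvd.intro_left a rfl).trans hD), ← Finset.mul_sum,
        vonMangoldt_sum, Nat.cast_mul,
        Real.log_mul (Nat.cast_ne_zero.mpr ha0) (Nat.cast_ne_zero.mpr hE0), add_sub_cancel_left]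
    · exact Finset.sum_eq_zero fun b _ ↦ if_neg fun h ↦ haD ((Dvd.intro b rfl).trans h)
  rw [Finset.sum_congr rfl hinner, ← Finset.sum_add_distrib, sq]
  nth_rewrite 1 [← vonMangoldt_sum]
  rw [← hfilter D hD, Finset.sum_filter, Finset.sum_mul]
  refine Finset.sum_congr rfl fun a _ ↦ ?_
  split_ifs <;> ring

open ArithmeticFunction in
lemma vonMangoldt_div_totient_le (n : ℕ) :
    vonMangoldt n / (n.totient : ℝ) ≤ 2 * (vonMangoldt n / n) := by
  by_cases hn : IsPrimePow n
  · have htot : n ≤ 2 * n.totient := by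
      obtain ⟨p, k, hp, hk, rfl⟩ := (isPrimePow_nat_iff n).mp hn
      obtain ⟨m, rfl⟩ := Nat.exists_eq_succ_of_ne_zero hk.ne'
      rw [Nat.succ_eq_add_one, Nat.totient_prime_pow_succ hp, pow_succ]
      have : p ≤ 2 * (p - 1) := by have := hp.two_le; omega
      calc p ^ m * p ≤ p ^ m * (2 * (p - 1)) := Nat.mul_le_mul_left _ this
        _ = _ := by ring
    have hpos : 0 < n := hn.pos
    have hn0 : (0 : ℝ) < n := by exact_mod_cast hpos
    have ht0 : (0 : ℝ) < n.totient := by exact_mod_cast Nat.totient_pos.mpr hpos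
    have htot' : (n : ℝ) ≤ 2 * n.totient := by exact_mod_cast htot
    rw [← mul_div_assoc, div_le_div_iff₀ ht0 hn0]
    nlinarith [vonMangoldt_nonneg (n := n)]
  · simp [vonMangoldt_eq_zero_iff.mpr hn]

lemma card_dirichletCharacter_complex (q : ℕ) [NeZero q] [Fintype (DirichletCharacter ℂ q)] :
    Fintype.card (DirichletCharacter ℂ q) = q.totient := by
  rw [← Nat.card_eq_fintype_card, DirichletCharacter.card_eq_totient_of_hasEnoughRootsOfUnity]

lemma card_dvd_div_conductor_mul_totient_le {q : ℕ} [NeZero q]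
    [Fintype (DirichletCharacter ℂ q)] (d : ℕ) :
    (Finset.univ.filter fun χ : DirichletCharacter ℂ q ↦ d ∣ q / χ.conductor).card * d.totient ≤
      q.totient := by
  by_cases hd : d ∣ q
  · obtain ⟨m, hm⟩ := hd
    have hmq : m ∣ q := ⟨d, by rw [hm, mul_comm]⟩
    have : NeZero m := ⟨ne_zero_of_dvd_ne_zero (NeZero.ne q) hmq⟩
    have hd0 : 0 < d := Nat.pos_of_ne_zero (left_ne_zero_of_mul (hm ▸ NeZero.ne q))
    let _ := Fintype.ofFinite (DirichletCharacter ℂ m)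
    have hcard : (Finset.univ.filter fun χ : DirichletCharacter ℂ q ↦
        d ∣ q / χ.conductor).card ≤ m.totient := by
      rw [← card_dirichletCharacter_complex m, ← Finset.card_univ]
      refine (Finset.card_le_card fun χ hχ ↦ ?_).trans
        (Finset.card_image_le (f := DirichletCharacter.changeLevel hmq))
      obtain ⟨e, he⟩ := (Finset.mem_filter.mp hχ).2
      have hcond : χ.conductor ∣ m := by
        refine ⟨e, Nat.eq_of_mul_eq_mul_left hd0 ?_⟩
        calc d * m = χ.conductor * (q / χ.conductor) := by
              rw [Nat.mul_div_cancel' χ.conductor_dvd_level, hm]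
          _ = d * (χ.conductor * e) := by rw [he]; ring
      obtain ⟨_, χ₀, hχ₀⟩ := (χ.mem_conductorSet_iff_conductor_dvd hmq).mpr hcond
      exact Finset.mem_image.mpr ⟨χ₀, Finset.mem_univ _, hχ₀.symm⟩
    calc _ ≤ m.totient * d.totient := Nat.mul_le_mul_right _ hcard
      _ ≤ (m * d).totient := Nat.totient_super_multiplicative m d
      _ = q.totient := by rw [hm, mul_comm]
  · rw [Finset.filter_false_of_mem, Finset.card_empty, zero_mul]
    · exact Nat.zero_le _
    · exact fun χ _ h ↦ hd (h.trans (Nat.div_dvd_of_dvd χ.conductor_dvd_level))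

lemma sum_ite_dvd_div_conductor_le {q : ℕ} [NeZero q] [Fintype (DirichletCharacter ℂ q)]
    {d : ℕ} (hd : 0 < d) {c : ℝ} (hc : 0 ≤ c) :
    ∑ χ : DirichletCharacter ℂ q, (if d ∣ q / χ.conductor then c else 0) ≤
      q.totient * (c / d.totient) := by
  have ht0 : (0 : ℝ) < d.totient := by exact_mod_cast Nat.totient_pos.mpr hd
  have hcard : ((Finset.univ.filter fun χ : DirichletCharacter ℂ q ↦
      d ∣ q / χ.conductor).card : ℝ) * d.totient ≤ q.totient := by
    exact_mod_cast card_dvd_div_conductor_mul_totient_le d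
  rw [← Finset.sum_filter, Finset.sum_const, nsmul_eq_mul, ← mul_div_assoc, le_div_iff₀ ht0]
  calc _ = c * (((Finset.univ.filter fun χ : DirichletCharacter ℂ q ↦
      d ∣ q / χ.conductor).card : ℝ) * d.totient) := by ring
    _ ≤ c * q.totient := mul_le_mul_of_nonneg_left hcard hc
    _ = _ := mul_comm _ _

open ArithmeticFunction in
lemma sum_log_div_conductor_sq_le (q : ℕ) [NeZero q] [Fintype (DirichletCharacter ℂ q)] :
    ∑ χ : DirichletCharacter ℂ q, Real.log (q / χ.conductor : ℕ) ^ 2 ≤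
      q.totient * (2 * ∑ a ∈ q.divisors, vonMangoldt a * Real.log a / a +
        4 * (∑ a ∈ q.divisors, vonMangoldt a / a) ^ 2) := by
  have hq : q ≠ 0 := NeZero.ne q
  calc ∑ χ : DirichletCharacter ℂ q, Real.log (q / χ.conductor : ℕ) ^ 2
      = ∑ a ∈ q.divisors, ∑ χ : DirichletCharacter ℂ q,
          (if a ∣ q / χ.conductor then vonMangoldt a * Real.log a else 0) +
        ∑ a ∈ q.divisors, ∑ b ∈ q.divisors, ∑ χ : DirichletCharacter ℂ q,
          (if a * b ∣ q / χ.conductor then vonMangoldt a * vonMangoldt b else 0) := by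
        rw [Finset.sum_congr rfl fun χ _ ↦
          log_sq_eq_sum_divisors (Nat.div_dvd_of_dvd χ.conductor_dvd_level) hq,
          Finset.sum_add_distrib, Finset.sum_comm]
        congr 1
        rw [Finset.sum_comm]
        exact Finset.sum_congr rfl fun a _ ↦ Finset.sum_comm
    _ ≤ ∑ a ∈ q.divisors, q.totient * (2 * (vonMangoldt a * Real.log a / a)) +
        ∑ a ∈ q.divisors, ∑ b ∈ q.divisors,
          q.totient * (4 * (vonMangoldt a / a * (vonMangoldt b / b))) := by
        refine add_le_add (Finset.sum_le_sum fun a ha ↦ ?_)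
          (Finset.sum_le_sum fun a ha ↦ Finset.sum_le_sum fun b hb ↦ ?_)
        · have ha0 := Nat.pos_of_mem_divisors ha
          refine (sum_ite_dvd_div_conductor_le ha0
            (mul_nonneg vonMangoldt_nonneg (Real.log_natCast_nonneg a))).trans ?_
          refine mul_le_mul_of_nonneg_left ?_ (Nat.cast_nonneg _)
          calc vonMangoldt a * Real.log a / a.totient
              = vonMangoldt a / a.totient * Real.log a := by ring
            _ ≤ 2 * (vonMangoldt a / a) * Real.log a :=
                mul_le_mul_of_nonneg_right (vonMangoldt_div_totient_le a)
                  (Real.log_natCast_nonneg a)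
            _ = _ := by ring
        · have ha0 := Nat.pos_of_mem_divisors ha
          have hb0 := Nat.pos_of_mem_divisors hb
          refine (sum_ite_dvd_div_conductor_le (Nat.mul_pos ha0 hb0)
            (mul_nonneg vonMangoldt_nonneg vonMangoldt_nonneg)).trans ?_
          refine mul_le_mul_of_nonneg_left ?_ (Nat.cast_nonneg _)
          have hta : (0 : ℝ) < a.totient := by exact_mod_cast Nat.totient_pos.mpr ha0
          have htb : (0 : ℝ) < b.totient := by exact_mod_cast Nat.totient_pos.mpr hb0
          have hmul : (a.totient : ℝ) * b.totient ≤ (a * b).totient := by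
            exact_mod_cast Nat.totient_super_multiplicative a b
          calc vonMangoldt a * vonMangoldt b / (a * b).totient
              ≤ vonMangoldt a * vonMangoldt b / (a.totient * b.totient) :=
                div_le_div_of_nonneg_left (mul_nonneg vonMangoldt_nonneg vonMangoldt_nonneg)
                  (mul_pos hta htb) hmul
            _ = vonMangoldt a / a.totient * (vonMangoldt b / b.totient) := by
                rw [div_mul_div_comm]
            _ ≤ 2 * (vonMangoldt a / a) * (2 * (vonMangoldt b / b)) :=
                mul_le_mul (vonMangoldt_div_totient_le a) (vonMangoldt_div_totient_le b)
                  (div_nonneg vonMangoldt_nonneg htb.le)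
                  (mul_nonneg zero_le_two (div_nonneg vonMangoldt_nonneg a.cast_nonneg))
            _ = _ := by ring
    _ = _ := by
        simp only [← Finset.mul_sum, sq, ← Finset.sum_mul]
        ring

/-- The second moment of `log (q / q_χ)` over the characters modulo `q` is `O((log log q)²)`. -/
lemma exists_sum_log_div_conductor_sq_le :
    ∃ K : ℝ, 0 < K ∧ ∀ (q : ℕ) [NeZero q] [Fintype (DirichletCharacter ℂ q)], 3 ≤ q →
      ∑ χ : DirichletCharacter ℂ q, Real.log (q / χ.conductor : ℕ) ^ 2 ≤
        q.totient * (K * Real.log (Real.log q) ^ 2) := by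
  have hlog3 : 1 < Real.log 3 := by
    rw [Real.lt_log_iff_exp_lt (by norm_num)]
    exact Real.exp_one_lt_three
  set l := Real.log (Real.log 3) with hl
  have hl0 : 0 < l := Real.log_pos hlog3
  have h4 : 0 < Real.log 4 := Real.log_pos (by norm_num)
  set A := 1 + (Real.log 4 + 5) / l with hA
  have hA0 : 0 < A := by positivity
  refine ⟨2 * (A + 1 / l + 1 / l ^ 2) + 4 * A ^ 2, by positivity, fun q _ _ hq ↦ ?_⟩
  have hq3 : Real.log 3 ≤ Real.log q :=
    Real.log_le_log (by norm_num) (by exact_mod_cast hq)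
  have hq1 : 1 ≤ Real.log q := hlog3.le.trans hq3
  have hlL : l ≤ Real.log (Real.log q) := Real.log_le_log (by linarith) hq3
  have h1 := sum_divisors_vonMangoldt_div_le hq1
  have h2 := sum_divisors_vonMangoldt_mul_log_div_le hq1
  set L := Real.log (Real.log q) with hL
  have hL0 : 0 < L := hl0.trans_le hlL
  have hone : 1 ≤ L / l := (one_le_div hl0).mpr hlL
  have hAL : L + (Real.log 4 + 5) ≤ A * L := by
    have : A * L = L + (Real.log 4 + 5) * (L / l) := by rw [hA]; ring
    nlinarith
  have hS1 := h1.trans hAL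
  have hS2 : L * (L + (Real.log 4 + 4)) + (L + 1) ≤ (A + 1 / l + 1 / l ^ 2) * L ^ 2 := by
    have e : (A + 1 / l + 1 / l ^ 2) * L ^ 2 = L * (A * L) + L * (L / l) + (L / l) ^ 2 := by
      field_simp
    nlinarith
  have hS0 : 0 ≤ ∑ a ∈ q.divisors, ArithmeticFunction.vonMangoldt a / (a : ℝ) :=
    Finset.sum_nonneg fun a _ ↦
      div_nonneg ArithmeticFunction.vonMangoldt_nonneg a.cast_nonneg
  refine (sum_log_div_conductor_sq_le q).trans
    (mul_le_mul_of_nonneg_left ?_ (Nat.cast_nonneg _))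
  have hsq := pow_le_pow_left₀ hS0 hS1 2
  rw [mul_pow] at hsq
  linarith [h2.trans hS2]

lemma conductor_conjChar {q : ℕ} [NeZero q] (χ : DirichletCharacter ℂ q) :
    (conjChar χ).conductor = χ.conductor := by
  have h : conjChar χ = χ⁻¹ := MulChar.star_eq_inv χ
  rw [h, DirichletCharacter.conductor_inv]

theorem subset_with_big_conductors (w : ℕ → ℝ) (hw : ∀ q, 0 < w q)
    (hw0 : Tendsto w atTop (nhds 0)) :
    ∃ C : ℝ, 0 < C ∧ ∀ q : ℕ, 3 ≤ q → ∃ F : Finset (DirichletCharacter ℂ q),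
      (∀ χ : DirichletCharacter ℂ q, χ ∈ F ↔ conjChar χ ∈ F) ∧
      (Nat.totient q : ℝ) * (1 - C * w q ^ 2) ≤ F.card ∧
      ∀ χ ∈ F, |Real.log (DirichletCharacter.conductor χ) - Real.log q| ≤
        C * (w q)⁻¹ * Real.log (Real.log q) := by
  obtain ⟨K, hK0, hK⟩ := exists_sum_log_div_conductor_sq_le
  refine ⟨1 + K, by positivity, fun q hq ↦ ?_⟩
  have : NeZero q := ⟨by omega⟩
  let _ := Fintype.ofFinite (DirichletCharacter ℂ q)
  have hsum := hK q hq
  have hlog1 : 1 < Real.log q := by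
    rw [Real.lt_log_iff_exp_lt (by positivity)]
    exact Real.exp_one_lt_three.trans_le (by exact_mod_cast hq)
  set L := Real.log (Real.log q)
  have hL0 : 0 < L := Real.log_pos hlog1
  have hw' := hw q
  set T := (1 + K) * (w q)⁻¹ * L with hT
  have hT0 : 0 < T := by positivity
  refine ⟨Finset.univ.filter fun χ ↦ Real.log (q / χ.conductor : ℕ) ≤ T, fun χ ↦ ?_, ?_,
    fun χ hχ ↦ ?_⟩
  · simp [conductor_conjChar]
  · set B := Finset.univ.filter fun χ : DirichletCharacter ℂ q ↦
      ¬ Real.log (q / χ.conductor : ℕ) ≤ T with hB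
    have hcard : ((Finset.univ.filter fun χ : DirichletCharacter ℂ q ↦
        Real.log (q / χ.conductor : ℕ) ≤ T).card : ℝ) + B.card = q.totient := by
      rw [← card_dirichletCharacter_complex q, ← Finset.card_univ]
      exact_mod_cast Finset.card_filter_add_card_filter_not _
    have hmarkov : B.card * T ^ 2 ≤ q.totient * (K * L ^ 2) := by
      refine le_trans ?_ hsum
      calc B.card * T ^ 2 = ∑ χ ∈ B, T ^ 2 := by simp
        _ ≤ ∑ χ ∈ B, Real.log (q / χ.conductor : ℕ) ^ 2 := by
            refine Finset.sum_le_sum fun χ hχ ↦ ?_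
            rw [hB, Finset.mem_filter, not_le] at hχ
            exact pow_le_pow_left₀ hT0.le hχ.2.le 2
        _ ≤ _ := Finset.sum_le_sum_of_subset_of_nonneg (Finset.subset_univ _)
            fun _ _ _ ↦ sq_nonneg _
    have hKC : K * L ^ 2 ≤ (1 + K) * w q ^ 2 * T ^ 2 := by
      have : (1 + K) * w q ^ 2 * T ^ 2 = (1 + K) ^ 3 * L ^ 2 := by
        rw [hT]; field_simp
      rw [this]
      refine mul_le_mul_of_nonneg_right ?_ (sq_nonneg L)
      nlinarith [pow_pos hK0 2, pow_pos hK0 3]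
    have hbad : (B.card : ℝ) ≤ q.totient * ((1 + K) * w q ^ 2) := by
      refine le_of_mul_le_mul_right (hmarkov.trans ?_) (pow_pos hT0 2)
      rw [mul_assoc]
      exact mul_le_mul_of_nonneg_left hKC (Nat.cast_nonneg _)
    linarith
  · have hχ' := (Finset.mem_filter.mp hχ).2
    have hc0 : (χ.conductor : ℝ) ≠ 0 := Nat.cast_ne_zero.mpr χ.conductor_ne_zero
    have hq0 : (q : ℝ) ≠ 0 := Nat.cast_ne_zero.mpr (NeZero.ne q)
    have hnonneg := Real.log_natCast_nonneg (q / χ.conductor)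
    rw [Nat.cast_div χ.conductor_dvd_level hc0, Real.log_div hq0 hc0] at hχ' hnonneg
    rw [abs_sub_comm, abs_of_nonneg hnonneg]
    exact hχ'
end
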